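/- arXiv:math/0611319 — 3 statements merged into one kernel-verified Lean document; each statement's English description precedes it below -/
import Mathlib

section
/- Let u : ℝ × [0,∞) → ℝ be a smooth function, 2π-periodic in its first variable, with u(θ,t) > 0 everywhere, satisfying the normalized Yamabe flow ∂_t u = (1/4)(R − R̄)·u with R(θ,t) = u³·(4·∂²_θ u + u), R̄(t) = (∫_0^{2π} R u^{−2} dθ)/(∫_0^{2π} u^{−2} dθ), and ∫_0^{2π} u(θ,0)^{−2} dθ = 2π. Then there exists a constant C ≥ 1 such that 1/C ≤ u(θ,t) ≤ C for all θ ∈ ℝ and all t ∈ [0,∞). -/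
open Real MeasureTheory

theorem sq_integral_mul_le {a b : ℝ} (hab : a ≤ b) {f g : ℝ → ℝ} (hf : Continuous f)
    (hg : Continuous g) :
    (∫ x in a..b, f x * g x) ^ 2 ≤ (∫ x in a..b, f x ^ 2) * ∫ x in a..b, g x ^ 2 := by
  have key : ∀ s : ℝ, 0 ≤ (∫ x in a..b, f x ^ 2) * (s * s) +
      (2 * ∫ x in a..b, f x * g x) * s + ∫ x in a..b, g x ^ 2 := by
    intro s
    have h : ∫ x in a..b, (s * f x + g x) ^ 2 = (∫ x in a..b, f x ^ 2) * (s * s) +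
        (2 * ∫ x in a..b, f x * g x) * s + ∫ x in a..b, g x ^ 2 := by
      rw [← intervalIntegral.integral_mul_const, ← intervalIntegral.integral_const_mul,
        ← intervalIntegral.integral_mul_const, ← intervalIntegral.integral_add,
        ← intervalIntegral.integral_add]
      · exact intervalIntegral.integral_congr fun x _ => by ring
      all_goals exact Continuous.intervalIntegrable (by fun_prop) _ _
    rw [← h]
    exact intervalIntegral.integral_nonneg hab fun x _ => sq_nonneg _
  have := discrim_le_zero key
  unfold discrim at this
  linarith

theorem integral_mul_le_sqrt_mul_sqrt {a b : ℝ} (hab : a ≤ b) {f g : ℝ → ℝ} (hf : Continuous f)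
    (hg : Continuous g) :
    ∫ x in a..b, f x * g x ≤ √(∫ x in a..b, f x ^ 2) * √(∫ x in a..b, g x ^ 2) := by
  rw [← Real.sqrt_mul (intervalIntegral.integral_nonneg hab fun x _ => sq_nonneg _)]
  exact Real.le_sqrt_of_sq_le (sq_integral_mul_le hab hf hg)

theorem periodic_deriv_of_hasDerivAt {f f' : ℝ → ℝ} {T : ℝ} (hf : ∀ x, HasDerivAt f (f' x) x)
    (hper : Function.Periodic f T) : Function.Periodic f' T := fun x =>
  ((hf (x + T)).comp_add_const x T).unique (by simpa only [hper _] using hf x)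

theorem antiperiodic_deriv_of_hasDerivAt {f f' : ℝ → ℝ} {T : ℝ}
    (hf : ∀ x, HasDerivAt f (f' x) x) (hper : Function.Antiperiodic f T) :
    Function.Antiperiodic f' T := fun x =>
  ((hf (x + T)).comp_add_const x T).unique (by simpa only [hper _] using (hf x).fun_neg)

theorem periodic_le_add_integral {f f' g : ℝ → ℝ} (hf : ∀ x, HasDerivAt f (f' x) x)
    (hf' : Continuous f') (hg : Continuous g) (hper : Function.Periodic f (2 * π))
    (hfg : ∀ x, |f' x| ≤ g x) (x y : ℝ) : f x ≤ f y + ∫ s in (0:ℝ)..(2 * π), g s := by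
  obtain ⟨z, ⟨hz1, hz2⟩, hz⟩ := hper.exists_mem_Ico two_pi_pos x y
  have hper' := periodic_deriv_of_hasDerivAt hf hper
  have habs : Function.Periodic (fun s => |f' s|) (2 * π) := fun s => by simp only [hper' s]
  have h1 : ∫ s in y..z, f' s = f z - f y :=
    intervalIntegral.integral_eq_sub_of_hasDerivAt (fun s _ => hf s) (hf'.intervalIntegrable _ _)
  have h2 : ∫ s in y..z, f' s ≤ ∫ s in y..z, |f' s| :=
    intervalIntegral.integral_mono_on hz1 (hf'.intervalIntegrable _ _)
      (hf'.abs.intervalIntegrable _ _) fun s _ => le_abs_self _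
  have h3 : ∫ s in y..z, |f' s| ≤ ∫ s in y..(y + 2 * π), |f' s| :=
    intervalIntegral.integral_mono_interval le_rfl hz1 hz2.le
      (Filter.Eventually.of_forall fun s => abs_nonneg _) (hf'.abs.intervalIntegrable _ _)
  have h4 : ∫ s in y..(y + 2 * π), |f' s| = ∫ s in (0:ℝ)..(2 * π), |f' s| := by
    simpa using habs.intervalIntegral_add_eq y 0
  have h5 : ∫ s in (0:ℝ)..(2 * π), |f' s| ≤ ∫ s in (0:ℝ)..(2 * π), g s :=
    intervalIntegral.integral_mono_on two_pi_pos.le (hf'.abs.intervalIntegrable _ _)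
      (hg.intervalIntegrable _ _) fun s _ => hfg s
  rw [hz]
  linarith

theorem integral_deriv_eq_zero_of_periodic {f f' : ℝ → ℝ} (hf : ∀ x, HasDerivAt f (f' x) x)
    (hf' : Continuous f') (hper : Function.Periodic f (2 * π)) :
    ∫ s in (0:ℝ)..(2 * π), f' s = 0 := by
  rw [intervalIntegral.integral_eq_sub_of_hasDerivAt (fun s _ => hf s)
    (hf'.intervalIntegrable _ _), ← hper 0, zero_add, sub_self]

/-- Wirtinger's inequality for antiperiodic functions, with respect to a weighted arc length. -/
theorem integral_weight_mul_sq_le {w y y' : ℝ → ℝ} (hw : Continuous w) (hwpos : ∀ x, 0 < w x)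
    (hwper : Function.Periodic w (2 * π)) (hwint : ∫ x in (0:ℝ)..(2 * π), w x = 2 * π)
    (hy : ∀ x, HasDerivAt y (y' x) x) (hy' : Continuous y')
    (hyper : Function.Antiperiodic y (2 * π)) :
    ∫ x in (0:ℝ)..(2 * π), w x * y x ^ 2 ≤ ∫ x in (0:ℝ)..(2 * π), 4 * y' x ^ 2 / w x := by
  have hyc : Continuous y := continuous_iff_continuousAt.2 fun x => (hy x).continuousAt
  have hyper' := antiperiodic_deriv_of_hasDerivAt hy hyper
  have hw0 : ∀ x, w x ≠ 0 := fun x => (hwpos x).ne'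
  obtain ⟨p, hp⟩ : ∃ p, y p = 0 := by
    have h0 : y (2 * π) = - y 0 := by simpa using hyper 0
    rcases le_total (y 0) 0 with h | h
    · exact mem_range_of_exists_le_of_exists_ge hyc ⟨0, h⟩ ⟨2 * π, by linarith⟩
    · exact mem_range_of_exists_le_of_exists_ge hyc ⟨2 * π, by linarith⟩ ⟨0, h⟩
  have hp' : y (p + 2 * π) = 0 := by rw [hyper, hp, neg_zero]
  have e1 : ∫ x in (0:ℝ)..(2 * π), w x * y x ^ 2 = ∫ x in p..(p + 2 * π), w x * y x ^ 2 := by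
    have : Function.Periodic (fun x => w x * y x ^ 2) (2 * π) := fun x => by
      simp only [hwper x, hyper x]; ring
    simpa using this.intervalIntegral_add_eq 0 p
  have e2 : ∫ x in (0:ℝ)..(2 * π), 4 * y' x ^ 2 / w x =
      ∫ x in p..(p + 2 * π), 4 * y' x ^ 2 / w x := by
    have : Function.Periodic (fun x => 4 * y' x ^ 2 / w x) (2 * π) := fun x => by
      simp only [hwper x, hyper' x]; ring
    simpa using this.intervalIntegral_add_eq 0 p
  have e3 : ∫ x in p..(p + 2 * π), w x = 2 * π := by
    have := hwper.intervalIntegral_add_eq p 0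
    rw [zero_add] at this
    exact this.trans hwint
  rw [e1, e2]
  have hle : p ≤ p + 2 * π := by linarith [two_pi_pos]
  set τ : ℝ → ℝ := fun x => (∫ s in p..x, w s) - π with hτ
  have hτd : ∀ x, HasDerivAt τ (w x) x := fun x =>
    (intervalIntegral.integral_hasDerivAt_right (hw.intervalIntegrable _ _)
      (hw.stronglyMeasurableAtFilter _ _) hw.continuousAt).sub_const _
  have hτc : Continuous τ := continuous_iff_continuousAt.2 fun x => (hτd x).continuousAt
  have hτmem : ∀ x ∈ Set.Icc p (p + 2 * π), -π ≤ τ x ∧ τ x ≤ π := by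
    intro x hx
    have h1 : 0 ≤ ∫ s in p..x, w s :=
      intervalIntegral.integral_nonneg hx.1 fun s _ => (hwpos s).le
    have h2 : ∫ s in p..x, w s ≤ ∫ s in p..(p + 2 * π), w s :=
      intervalIntegral.integral_mono_interval le_rfl hx.1 hx.2
        (Filter.Eventually.of_forall fun s => (hwpos s).le) (hw.intervalIntegrable _ _)
    constructor <;> simp only [hτ] <;> linarith
  have key : ∀ k ∈ Set.Ioo (0:ℝ) 1, k ^ 2 * ∫ x in p..(p + 2 * π), w x * y x ^ 2 ≤
      ∫ x in p..(p + 2 * π), 4 * y' x ^ 2 / w x := by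
    rintro k ⟨hk0, hk1⟩
    have hcos : ∀ x ∈ Set.Icc p (p + 2 * π), 0 < Real.cos (k * τ x / 2) := by
      intro x hx
      obtain ⟨h1, h2⟩ := hτmem x hx
      apply Real.cos_pos_of_mem_Ioo
      constructor <;> nlinarith [pi_pos]
    set T : ℝ → ℝ := fun x => Real.tan (k * τ x / 2) with hT
    have hTd : ∀ x ∈ Set.Icc p (p + 2 * π),
        HasDerivAt T (k / 2 * w x * (1 + T x ^ 2)) x := by
      intro x hx
      have hc := (hcos x hx).ne'
      have h := (Real.hasDerivAt_tan hc).comp x (((hτd x).const_mul k).div_const 2)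
      refine h.congr_deriv ?_
      simp only [hT, Real.tan_eq_sin_div_cos]
      field_simp
      linear_combination (-w x) * Real.sin_sq_add_cos_sq (k * τ x / 2)
    have hTc : ContinuousOn T (Set.Icc p (p + 2 * π)) := fun x hx =>
      (hTd x hx).continuousAt.continuousWithinAt
    have hG : ∀ x ∈ Set.uIcc p (p + 2 * π), HasDerivAt (fun x => 2 * k * (y x ^ 2 * T x))
        (2 * k * (2 * y x * y' x * T x + y x ^ 2 * (k / 2 * w x * (1 + T x ^ 2)))) x := by
      intro x hx
      rw [Set.uIcc_of_le hle] at hx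
      refine ((((hy x).pow 2).mul (hTd x hx)).const_mul (2 * k)).congr_deriv ?_
      simp
    have hGc : ContinuousOn (fun x =>
        2 * k * (2 * y x * y' x * T x + y x ^ 2 * (k / 2 * w x * (1 + T x ^ 2))))
        (Set.uIcc p (p + 2 * π)) := by
      rw [Set.uIcc_of_le hle]
      fun_prop
    have hG0 := intervalIntegral.integral_eq_sub_of_hasDerivAt hG hGc.intervalIntegrable
    rw [hp, hp'] at hG0
    have i1 : IntervalIntegrable (fun x => k ^ 2 * (w x * y x ^ 2)) volume p (p + 2 * π) :=
      Continuous.intervalIntegrable (by fun_prop) _ _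
    have i2 : IntervalIntegrable (fun x => 4 * y' x ^ 2 / w x) volume p (p + 2 * π) :=
      Continuous.intervalIntegrable (by fun_prop (disch := assumption)) _ _
    have hmono := intervalIntegral.integral_mono_on hle i1
      (i2.add hGc.intervalIntegrable) (fun x _ => by
        have h := sq_nonneg (2 * y' x + k * w x * y x * T x)
        have hdiv : 4 * y' x ^ 2 / w x +
            2 * k * (2 * y x * y' x * T x + y x ^ 2 * (k / 2 * w x * (1 + T x ^ 2))) -
            k ^ 2 * (w x * y x ^ 2) = (2 * y' x + k * w x * y x * T x) ^ 2 / w x := by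
          field_simp [hw0 x]
          ring
        have := div_nonneg h (hwpos x).le
        show _ ≤ 4 * y' x ^ 2 / w x + _
        linarith)
    rw [intervalIntegral.integral_const_mul] at hmono
    rw [intervalIntegral.integral_add i2 hGc.intervalIntegrable, hG0] at hmono
    simpa using hmono
  have hlim : Filter.Tendsto (fun k : ℝ => k ^ 2 * ∫ x in p..(p + 2 * π), w x * y x ^ 2)
      (nhdsWithin 1 (Set.Iio 1)) (nhds (1 ^ 2 * ∫ x in p..(p + 2 * π), w x * y x ^ 2)) :=
    (Continuous.tendsto (by fun_prop) 1).mono_left nhdsWithin_le_nhds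
  rw [one_pow, one_mul] at hlim
  refine le_of_tendsto hlim ?_
  filter_upwards [Ioo_mem_nhdsLT (show (0:ℝ) < 1 by norm_num)] with k hk using key k hk

theorem exists_forall_le_of_periodic {f : ℝ → ℝ} (hf : Continuous f)
    (hper : Function.Periodic f (2 * π)) : ∃ p, ∀ x, f x ≤ f p := by
  obtain ⟨p, -, hp⟩ := isCompact_Icc.exists_isMaxOn (Set.nonempty_Icc.2 two_pi_pos.le)
    (hf.continuousOn (s := Set.Icc 0 (2 * π)))
  refine ⟨p, fun x => ?_⟩
  obtain ⟨y, hy, hxy⟩ := hper.exists_mem_Ico₀ two_pi_pos x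
  rw [hxy]
  exact hp (Set.Ico_subset_Icc_self hy)

theorem exists_forall_ge_of_periodic {f : ℝ → ℝ} (hf : Continuous f)
    (hper : Function.Periodic f (2 * π)) : ∃ p, ∀ x, f p ≤ f x := by
  obtain ⟨p, hp⟩ := exists_forall_le_of_periodic hf.neg fun x => congrArg Neg.neg (hper x)
  exact ⟨p, fun x => neg_le_neg_iff.1 (hp x)⟩

/-- A positive `2π`-periodic `C²` function `u`, with derivatives `u'` and `u''`, such that the
circle with metric `u⁻⁴ dθ²` has length `2π`. -/
structure NormalizedFactor (u u' u'' : ℝ → ℝ) : Prop where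
  deriv1 : ∀ x, HasDerivAt u (u' x) x
  deriv2 : ∀ x, HasDerivAt u' (u'' x) x
  continuous2 : Continuous u''
  periodic : Function.Periodic u (2 * π)
  pos : ∀ x, 0 < u x
  length : ∫ x in (0:ℝ)..(2 * π), ((u x) ^ 2)⁻¹ = 2 * π

/-- The 4-scalar curvature of `u⁻⁴ dθ²`. -/
def curv (u u'' : ℝ → ℝ) (x : ℝ) : ℝ := u x ^ 3 * (4 * u'' x + u x)

/-- The mean of the 4-scalar curvature when the total length is `2π`. -/
noncomputable def meanCurv (u u'' : ℝ → ℝ) : ℝ :=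
  (∫ x in (0:ℝ)..(2 * π), curv u u'' x * ((u x) ^ 2)⁻¹) / (2 * π)

/-- The squared `L²` distance of the 4-scalar curvature to its mean. -/
noncomputable def curvVariance (u u'' : ℝ → ℝ) : ℝ :=
  ∫ x in (0:ℝ)..(2 * π), (curv u u'' x - meanCurv u u'') ^ 2 * ((u x) ^ 2)⁻¹

theorem integral_curv (u u'' : ℝ → ℝ) :
    ∫ x in (0:ℝ)..(2 * π), curv u u'' x * ((u x) ^ 2)⁻¹ = 2 * π * meanCurv u u'' := by
  unfold meanCurv
  field_simp

namespace NormalizedFactor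

variable {u u' u'' : ℝ → ℝ}

theorem continuous0 (h : NormalizedFactor u u' u'') : Continuous u :=
  continuous_iff_continuousAt.2 fun x => (h.deriv1 x).continuousAt

theorem continuous1 (h : NormalizedFactor u u' u'') : Continuous u' :=
  continuous_iff_continuousAt.2 fun x => (h.deriv2 x).continuousAt

theorem ne_zero (h : NormalizedFactor u u' u'') (x : ℝ) : u x ≠ 0 := (h.pos x).ne'

theorem periodic1 (h : NormalizedFactor u u' u'') : Function.Periodic u' (2 * π) :=
  periodic_deriv_of_hasDerivAt h.deriv1 h.periodic

theorem periodic2 (h : NormalizedFactor u u' u'') : Function.Periodic u'' (2 * π) :=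
  periodic_deriv_of_hasDerivAt h.deriv2 h.periodic1

theorem continuous_weight (h : NormalizedFactor u u' u'') :
    Continuous fun x => ((u x) ^ 2)⁻¹ :=
  (h.continuous0.pow 2).inv₀ fun x => pow_ne_zero 2 (h.ne_zero x)

theorem weight_pos (h : NormalizedFactor u u' u'') (x : ℝ) : 0 < ((u x) ^ 2)⁻¹ :=
  inv_pos.2 (pow_pos (h.pos x) 2)

theorem continuous_curv (h : NormalizedFactor u u' u'') : Continuous (curv u u'') := by
  have := h.continuous0
  have := h.continuous2
  unfold curv
  fun_prop

theorem integral_curv_eq (h : NormalizedFactor u u' u'') :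
    ∫ x in (0:ℝ)..(2 * π), curv u u'' x * ((u x) ^ 2)⁻¹ =
      ∫ x in (0:ℝ)..(2 * π), (u x ^ 2 - 4 * u' x ^ 2) := by
  have c0 := h.continuous0
  have c1 := h.continuous1
  have c2 := h.continuous2
  have h0 : ∫ x in (0:ℝ)..(2 * π), 4 * (u' x * u' x + u x * u'' x) = 0 :=
    integral_deriv_eq_zero_of_periodic
      (f := fun x => 4 * (u x * u' x))
      (fun x => ((h.deriv1 x).mul (h.deriv2 x)).const_mul 4) (by fun_prop)
      fun x => by simp only [h.periodic x, h.periodic1 x]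
  have h1 : ∫ x in (0:ℝ)..(2 * π), curv u u'' x * ((u x) ^ 2)⁻¹ =
      (∫ x in (0:ℝ)..(2 * π), (u x ^ 2 - 4 * u' x ^ 2)) +
        ∫ x in (0:ℝ)..(2 * π), 4 * (u' x * u' x + u x * u'' x) := by
    rw [← intervalIntegral.integral_add]
    · refine intervalIntegral.integral_congr fun x _ => ?_
      have := h.ne_zero x
      simp only [curv]
      field_simp
      ring
    all_goals exact Continuous.intervalIntegrable (by fun_prop) _ _
  rw [h1, h0, add_zero]

theorem meanCurv_le_one (h : NormalizedFactor u u' u'') : meanCurv u u'' ≤ 1 := by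
  have c0 := h.continuous0
  have c1 := h.continuous1
  have cw := h.continuous_weight
  have wper : Function.Periodic (fun x => ((u x) ^ 2)⁻¹) (2 * π) := fun x => by
    simp only [h.periodic x]
  set σ : ℝ → ℝ := fun x => ∫ s in (0:ℝ)..x, ((u s) ^ 2)⁻¹ with hσ
  have hσd : ∀ x, HasDerivAt σ (((u x) ^ 2)⁻¹) x := fun x =>
    intervalIntegral.integral_hasDerivAt_right (cw.intervalIntegrable _ _)
      (cw.stronglyMeasurableAtFilter _ _) cw.continuousAt
  have cσ : Continuous σ := continuous_iff_continuousAt.2 fun x => (hσd x).continuousAt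
  have hσper : ∀ x, σ (x + 2 * π) = σ x + 2 * π := by
    intro x
    have h1 := wper.intervalIntegral_add_eq x 0
    rw [zero_add, h.length] at h1
    have h2 : (∫ s in (0:ℝ)..x, ((u s) ^ 2)⁻¹) + ∫ s in x..(x + 2 * π), ((u s) ^ 2)⁻¹ =
        ∫ s in (0:ℝ)..(x + 2 * π), ((u s) ^ 2)⁻¹ :=
      intervalIntegral.integral_add_adjacent_intervals (cw.intervalIntegrable _ _)
        (cw.intervalIntegrable _ _)
    simp only [hσ]
    linarith
  have half : ∀ x, σ (x + 2 * π) / 2 = σ x / 2 + π := fun x => by rw [hσper]; ring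
  have wirt : ∀ y y' : ℝ → ℝ, (∀ x, HasDerivAt y (y' x) x) → Continuous y' →
      Function.Antiperiodic y (2 * π) →
      ∫ x in (0:ℝ)..(2 * π), y x ^ 2 ≤ ∫ x in (0:ℝ)..(2 * π), 4 * y' x ^ 2 := by
    intro y y' hy hy' hyper
    simpa using integral_weight_mul_sq_le (w := fun _ => 1) continuous_const
      (fun _ => one_pos) (fun _ => rfl) (by simp) hy hy' hyper
  have hc : ∀ x, HasDerivAt (fun x => u x * Real.cos (σ x / 2))
      (u' x * Real.cos (σ x / 2) + u x * (-Real.sin (σ x / 2) * (((u x) ^ 2)⁻¹ / 2))) x :=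
    fun x => (h.deriv1 x).mul ((hσd x).div_const 2).cos
  have hs : ∀ x, HasDerivAt (fun x => u x * Real.sin (σ x / 2))
      (u' x * Real.sin (σ x / 2) + u x * (Real.cos (σ x / 2) * (((u x) ^ 2)⁻¹ / 2))) x :=
    fun x => (h.deriv1 x).mul ((hσd x).div_const 2).sin
  have w1 := wirt _ _ hc (by fun_prop) fun x => by
    simp only [h.periodic x, half, Real.cos_add_pi]; ring
  have w2 := wirt _ _ hs (by fun_prop) fun x => by
    simp only [h.periodic x, half, Real.sin_add_pi]; ring
  have w3 := add_le_add w1 w2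
  rw [← intervalIntegral.integral_add, ← intervalIntegral.integral_add] at w3
  rotate_left
  iterate 4 exact Continuous.intervalIntegrable (by fun_prop) _ _
  have e1 : ∫ x in (0:ℝ)..(2 * π),
      ((u x * Real.cos (σ x / 2)) ^ 2 + (u x * Real.sin (σ x / 2)) ^ 2) =
      ∫ x in (0:ℝ)..(2 * π), u x ^ 2 :=
    intervalIntegral.integral_congr fun x _ => by
      linear_combination u x ^ 2 * Real.sin_sq_add_cos_sq (σ x / 2)
  have e2 : ∫ x in (0:ℝ)..(2 * π),
      (4 * (u' x * Real.cos (σ x / 2) + u x * (-Real.sin (σ x / 2) * (((u x) ^ 2)⁻¹ / 2))) ^ 2 +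
        4 * (u' x * Real.sin (σ x / 2) + u x * (Real.cos (σ x / 2) * (((u x) ^ 2)⁻¹ / 2))) ^ 2) =
      ∫ x in (0:ℝ)..(2 * π), (4 * u' x ^ 2 + ((u x) ^ 2)⁻¹) :=
    intervalIntegral.integral_congr fun x _ => by
      have := h.ne_zero x
      field_simp
      linear_combination (16 * u' x ^ 2 * u x ^ 2 + 4) * Real.sin_sq_add_cos_sq (σ x / 2)
  rw [e1, e2, intervalIntegral.integral_add (Continuous.intervalIntegrable (by fun_prop) _ _)
    (cw.intervalIntegrable _ _), h.length] at w3
  have e3 := integral_curv u u''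
  rw [h.integral_curv_eq, intervalIntegral.integral_sub
    (Continuous.intervalIntegrable (by fun_prop) _ _)
    (Continuous.intervalIntegrable (by fun_prop) _ _)] at e3
  nlinarith [two_pi_pos]

/-- The quotients `c / u` solve `x'' + (R / 4) x = 0` in arc length. -/
theorem hasDerivAt_jacobi (h : NormalizedFactor u u' u'') {c c' : ℝ → ℝ}
    (hc : ∀ x, HasDerivAt c (c' x) x) (x : ℝ) :
    HasDerivAt (fun x => c x / u x) ((u x * c' x - u' x * c x) * ((u x) ^ 2)⁻¹) x := by
  refine ((hc x).div (h.deriv1 x) (h.ne_zero x)).congr_deriv ?_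
  have := h.ne_zero x
  field_simp

theorem hasDerivAt_jacobi_deriv (h : NormalizedFactor u u' u'') {c c' : ℝ → ℝ}
    (hc : ∀ x, HasDerivAt c (c' x) x) (hc' : ∀ x, HasDerivAt c' (-c x / 4) x) (x : ℝ) :
    HasDerivAt (fun x => u x * c' x - u' x * c x)
      (-(curv u u'' x * ((u x) ^ 2)⁻¹ * (c x / u x)) / 4) x := by
  refine (((h.deriv1 x).mul (hc' x)).sub ((h.deriv2 x).mul (hc x))).congr_deriv ?_
  have := h.ne_zero x
  simp only [curv]
  field_simp
  ring

theorem integral_jacobi_nonneg (h : NormalizedFactor u u' u'') {c c' : ℝ → ℝ}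
    (hc : ∀ x, HasDerivAt c (c' x) x) (hc' : ∀ x, HasDerivAt c' (-c x / 4) x)
    (hper : Function.Antiperiodic c (2 * π)) :
    0 ≤ ∫ x in (0:ℝ)..(2 * π), (curv u u'' x - 1) * ((u x) ^ 2)⁻¹ * (c x / u x) ^ 2 := by
  have c0 := h.continuous0
  have c1 := h.continuous1
  have cw := h.continuous_weight
  have cR := h.continuous_curv
  have cc : Continuous c := continuous_iff_continuousAt.2 fun x => (hc x).continuousAt
  have cc' : Continuous c' := continuous_iff_continuousAt.2 fun x => (hc' x).continuousAt
  have hper' := antiperiodic_deriv_of_hasDerivAt hc hper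
  have hne := h.ne_zero
  have wirt := integral_weight_mul_sq_le cw h.weight_pos
    (fun x => by simp only [h.periodic x]) h.length (h.hasDerivAt_jacobi hc) (by fun_prop)
    fun x => by simp only [h.periodic x, hper x, neg_div]
  have parts := integral_deriv_eq_zero_of_periodic
    (fun x => (h.hasDerivAt_jacobi hc x).mul (h.hasDerivAt_jacobi_deriv hc hc' x))
    (by fun_prop (disch := assumption)) fun x => by
      simp only [Pi.mul_apply, h.periodic x, h.periodic1 x, hper x, hper' x]; ring
  have e : ∫ x in (0:ℝ)..(2 * π), (curv u u'' x - 1) * ((u x) ^ 2)⁻¹ * (c x / u x) ^ 2 =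
      (∫ x in (0:ℝ)..(2 * π),
        4 * ((u x * c' x - u' x * c x) * ((u x) ^ 2)⁻¹) ^ 2 / ((u x) ^ 2)⁻¹) -
      (∫ x in (0:ℝ)..(2 * π), ((u x) ^ 2)⁻¹ * (c x / u x) ^ 2) -
      4 * ∫ x in (0:ℝ)..(2 * π), ((u x * c' x - u' x * c x) * ((u x) ^ 2)⁻¹ *
        (u x * c' x - u' x * c x) +
          c x / u x * (-(curv u u'' x * ((u x) ^ 2)⁻¹ * (c x / u x)) / 4)) := by
    rw [← intervalIntegral.integral_const_mul, ← intervalIntegral.integral_sub,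
      ← intervalIntegral.integral_sub]
    · refine intervalIntegral.integral_congr fun x _ => ?_
      have := h.ne_zero x
      field_simp
      ring
    all_goals
      refine Continuous.intervalIntegrable ?_ _ _
      have hw0 := fun x => (h.weight_pos x).ne'
      fun_prop (disch := assumption)
  rw [e, parts]
  linarith

end NormalizedFactor

/-- If `R` is close to `1`, then the squared norm of a fundamental system `(p, q)` of solutions of
`x'' + (R / 4) x = 0` is close to `1`; primes are derivatives with respect to the arc length
`w dx`, and `(a, b)` is the derivative of `(p, q)`. -/
theorem jacobi_norm_sq_bounds {p q a b R w : ℝ → ℝ} (cR : Continuous R) (cw : Continuous w)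
    (hwpos : ∀ x, 0 < w x)
    (hp : ∀ x, HasDerivAt p (a x * w x) x) (hq : ∀ x, HasDerivAt q (b x * w x) x)
    (ha : ∀ x, HasDerivAt a (-(R x * w x * p x) / 4) x)
    (hb : ∀ x, HasDerivAt b (-(R x * w x * q x) / 4) x)
    (wpqab : ∀ x, p x * b x - q x * a x = 1 / 2)
    (p0 : p 0 = 1) (q0 : q 0 = 0) (a0 : a 0 = 0) (b0 : b 0 = 1 / 2)
    (pper : Function.Antiperiodic p (2 * π)) (qper : Function.Antiperiodic q (2 * π))
    (aper : Function.Antiperiodic a (2 * π)) (bper : Function.Antiperiodic b (2 * π))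
    {H : ℝ} (hH : H = ∫ x in (0:ℝ)..(2 * π), |1 - R x| * w x) :
    (∀ x, |p x ^ 2 + q x ^ 2 - 1| ≤ 2 * H * Real.exp (H / 2)) ∧
      ∀ x, 1 ≤ (p x ^ 2 + q x ^ 2) * (2 * Real.exp (H / 2)) := by
  have cp : Continuous p := continuous_iff_continuousAt.2 fun x => (hp x).continuousAt
  have cq : Continuous q := continuous_iff_continuousAt.2 fun x => (hq x).continuousAt
  have ca : Continuous a := continuous_iff_continuousAt.2 fun x => (ha x).continuousAt
  have cb : Continuous b := continuous_iff_continuousAt.2 fun x => (hb x).continuousAt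
  set κ : ℝ → ℝ := fun x => 4 * (p x * a x + q x * b x) with hκ
  set μ : ℝ → ℝ := fun x => p x ^ 2 + q x ^ 2 + 4 * (a x ^ 2 + b x ^ 2) with hμ
  have cκ : Continuous κ := by fun_prop
  have cμ : Continuous μ := by fun_prop
  have hμd : ∀ x, HasDerivAt μ ((1 - R x) * κ x * w x / 2) x := fun x =>
    ((((hp x).pow 2).add ((hq x).pow 2)).add
      ((((ha x).pow 2).add ((hb x).pow 2)).const_mul 4)).congr_deriv (by
        simp only [hκ]; push_cast; ring)
  have μper : Function.Periodic μ (2 * π) := fun x => by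
    simp only [hμ, pper x, qper x, aper x, bper x]; ring
  have hrel : ∀ x, (p x ^ 2 + q x ^ 2 - 4 * (a x ^ 2 + b x ^ 2)) ^ 2 + κ x ^ 2 =
      μ x ^ 2 - 4 := fun x => by
    simp only [hκ, hμ]
    linear_combination (-16) * (p x * b x - q x * a x + 1 / 2) * wpqab x
  have μnonneg : ∀ x, 0 ≤ μ x := fun x => by simp only [hμ]; positivity
  have μge : ∀ x, 2 ≤ μ x := fun x => by
    have := hrel x
    nlinarith [sq_nonneg (p x ^ 2 + q x ^ 2 - 4 * (a x ^ 2 + b x ^ 2)), sq_nonneg (κ x), μnonneg x]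
  have κle : ∀ x, |κ x| ≤ μ x := fun x => abs_le_of_sq_le_sq (by
    nlinarith [hrel x, sq_nonneg (p x ^ 2 + q x ^ 2 - 4 * (a x ^ 2 + b x ^ 2))]) (μnonneg x)
  have μ0 : μ 0 = 2 := by simp only [hμ, p0, q0, a0, b0]; norm_num
  obtain ⟨m, hm⟩ := exists_forall_le_of_periodic cμ μper
  have ch : Continuous fun x => |1 - R x| * w x := by fun_prop
  have hw0 : ∀ x, 0 ≤ |1 - R x| * w x := fun x =>
    mul_nonneg (abs_nonneg _) (hwpos x).le
  have H0 : 0 ≤ H := by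
    rw [hH]; exact intervalIntegral.integral_nonneg two_pi_pos.le fun x _ => hw0 x
  have μne : ∀ x, μ x ≠ 0 := fun x => by linarith [μge x]
  have μm : μ m ≤ 2 * Real.exp (H / 2) := by
    have hlog := periodic_le_add_integral (f := fun x => Real.log (μ x))
      (g := fun x => 1 / 2 * (|1 - R x| * w x))
      (fun x => (hμd x).log (μne x))
      (by fun_prop (disch := assumption)) (by fun_prop) (fun x => by simp only [μper x])
      (fun x => by
        have hx : 0 < μ x := by linarith [μge x]
        rw [abs_div, abs_of_pos hx, div_le_iff₀ hx, abs_div, abs_mul, abs_mul,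
          abs_of_pos (hwpos x), abs_two]
        nlinarith [mul_le_mul_of_nonneg_left (κle x) (hw0 x)]) m 0
    rw [intervalIntegral.integral_const_mul, ← hH, μ0] at hlog
    have := Real.exp_le_exp.2 hlog
    rw [Real.exp_log (by linarith [μge m]), Real.exp_add, Real.exp_log two_pos] at this
    rwa [div_eq_inv_mul, ← one_div]
  set ρ := √(μ m ^ 2 - 4) with hρ
  have ρ0 : 0 ≤ ρ := Real.sqrt_nonneg _
  have ρsq : ρ ^ 2 = μ m ^ 2 - 4 := Real.sq_sqrt (by nlinarith [μge m])
  have hmono : ∀ x, μ x ^ 2 ≤ μ m ^ 2 := fun x => pow_le_pow_left₀ (μnonneg x) (hm x) 2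
  have κρ : ∀ x, |κ x| ≤ ρ := fun x => abs_le_of_sq_le_sq (by
    nlinarith [hrel x, sq_nonneg (p x ^ 2 + q x ^ 2 - 4 * (a x ^ 2 + b x ^ 2)), hmono x]) ρ0
  have νρ : ∀ x, |p x ^ 2 + q x ^ 2 - 4 * (a x ^ 2 + b x ^ 2)| ≤ ρ := fun x =>
    abs_le_of_sq_le_sq (by nlinarith [hrel x, sq_nonneg (κ x), hmono x]) ρ0
  have ρle : ρ ≤ H * μ m := by
    have hsq := periodic_le_add_integral (f := fun x => μ x ^ 2)
      (g := fun x => ρ * μ m * (|1 - R x| * w x))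
      (fun x => (hμd x).pow 2)
      (by fun_prop) (by fun_prop) (fun x => by simp only [μper x])
      (fun x => by
        have e : |((2:ℕ):ℝ) * μ x ^ (2 - 1) * ((1 - R x) * κ x * w x / 2)| =
            |κ x| * μ x * (|1 - R x| * w x) := by
          rw [← abs_of_pos (hwpos x), ← abs_mul, ← abs_of_nonneg (μnonneg x), ← abs_mul,
            abs_of_pos (hwpos x), ← abs_mul, abs_of_nonneg (μnonneg x)]
          congr 1
          push_cast
          ring
        rw [e]
        exact mul_le_mul_of_nonneg_right
          (mul_le_mul (κρ x) (hm x) (μnonneg x) ρ0) (hw0 x)) m 0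
    rw [intervalIntegral.integral_const_mul, ← hH] at hsq
    have hsq' : μ m ^ 2 ≤ μ 0 ^ 2 + ρ * μ m * H := hsq
    rw [μ0] at hsq'
    by_contra hcon
    push Not at hcon
    have hρpos : 0 < ρ := lt_of_le_of_lt (mul_nonneg H0 (μnonneg m)) hcon
    have hlt := mul_lt_mul_of_pos_left hcon hρpos
    linarith [show ρ * (H * μ m) = ρ * μ m * H by ring, sq ρ]
  have ρle' : ρ ≤ 2 * H * Real.exp (H / 2) := by
    have := mul_le_mul_of_nonneg_left μm H0
    linarith
  refine ⟨fun x => ?_, fun x => ?_⟩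
  · have h1 := abs_le.1 (νρ x)
    have h2 : μ x - 2 ≤ ρ := by
      refine le_of_sq_le_sq ?_ ρ0
      nlinarith [hmono x, μge x]
    have h3 := μge x
    have h4 : μ x = p x ^ 2 + q x ^ 2 + 4 * (a x ^ 2 + b x ^ 2) := rfl
    rw [abs_le]
    constructor <;> linarith
  · have h1 : 0 ≤ p x ^ 2 + q x ^ 2 := by positivity
    have h2 : 1 ≤ (p x ^ 2 + q x ^ 2) * (4 * (a x ^ 2 + b x ^ 2)) := by
      nlinarith [wpqab x, sq_nonneg (p x * a x + q x * b x)]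
    have h3 : 4 * (a x ^ 2 + b x ^ 2) ≤ 2 * Real.exp (H / 2) := by
      have h4 : μ x = p x ^ 2 + q x ^ 2 + 4 * (a x ^ 2 + b x ^ 2) := rfl
      linarith [hm x]
    exact h2.trans (mul_le_mul_of_nonneg_left h3 h1)

namespace NormalizedFactor

variable {u u' u'' : ℝ → ℝ}

/-- The squared norm `ξ` of a fundamental system of solutions of `x'' + (R / 4) x = 0` is close
to `1` when `R` is close to `1`. -/
theorem exists_jacobi_norm_sq (h : NormalizedFactor u u' u'') {H : ℝ}
    (hH : H = ∫ x in (0:ℝ)..(2 * π), |1 - curv u u'' x| * ((u x) ^ 2)⁻¹) :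
    ∃ ξ : ℝ → ℝ, Continuous ξ ∧
      0 ≤ ∫ x in (0:ℝ)..(2 * π), (curv u u'' x - 1) * ((u x) ^ 2)⁻¹ * ξ x ∧
      (∀ x, |ξ x - 1| ≤ 2 * H * Real.exp (H / 2)) ∧
      ∀ x, 1 ≤ ξ x * (2 * Real.exp (H / 2)) := by
  have c0 := h.continuous0
  have c1 := h.continuous1
  have cw := h.continuous_weight
  have cR := h.continuous_curv
  have hne := h.ne_zero
  have hcos : ∀ x, HasDerivAt (fun x => Real.cos (x / 2)) (-Real.sin (x / 2) / 2) x := fun x => by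
    simpa [div_eq_mul_inv] using ((hasDerivAt_id x).div_const 2).cos
  have hsin : ∀ x, HasDerivAt (fun x => Real.sin (x / 2)) (Real.cos (x / 2) / 2) x := fun x => by
    simpa [div_eq_mul_inv] using ((hasDerivAt_id x).div_const 2).sin
  have half : ∀ x, (x + 2 * π) / 2 = x / 2 + π := fun x => by ring
  set c : ℝ → ℝ := fun x => u 0 * Real.cos (x / 2) + 2 * u' 0 * Real.sin (x / 2) with hc_def
  set c' : ℝ → ℝ := fun x => u' 0 * Real.cos (x / 2) - u 0 / 2 * Real.sin (x / 2) with hc'_def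
  set d : ℝ → ℝ := fun x => (u 0)⁻¹ * Real.sin (x / 2) with hd_def
  set d' : ℝ → ℝ := fun x => (u 0)⁻¹ / 2 * Real.cos (x / 2) with hd'_def
  have hc : ∀ x, HasDerivAt c (c' x) x := fun x =>
    (((hcos x).const_mul _).add ((hsin x).const_mul _)).congr_deriv (by
      simp only [hc'_def]; ring)
  have hc' : ∀ x, HasDerivAt c' (-c x / 4) x := fun x =>
    (((hcos x).const_mul _).sub ((hsin x).const_mul _)).congr_deriv (by
      simp only [hc_def]; ring)
  have hd : ∀ x, HasDerivAt d (d' x) x := fun x =>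
    ((hsin x).const_mul _).congr_deriv (by simp only [hd'_def]; ring)
  have hd' : ∀ x, HasDerivAt d' (-d x / 4) x := fun x =>
    ((hcos x).const_mul _).congr_deriv (by simp only [hd_def]; ring)
  have hcper : Function.Antiperiodic c (2 * π) := fun x => by
    simp only [hc_def, half, Real.cos_add_pi, Real.sin_add_pi]; ring
  have hdper : Function.Antiperiodic d (2 * π) := fun x => by
    simp only [hd_def, half, Real.sin_add_pi]; ring
  have hcper' := antiperiodic_deriv_of_hasDerivAt hc hcper
  have hdper' := antiperiodic_deriv_of_hasDerivAt hd hdper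
  have cc : Continuous c := continuous_iff_continuousAt.2 fun x => (hc x).continuousAt
  have cc' : Continuous c' := continuous_iff_continuousAt.2 fun x => (hc' x).continuousAt
  have cd : Continuous d := continuous_iff_continuousAt.2 fun x => (hd x).continuousAt
  have cd' : Continuous d' := continuous_iff_continuousAt.2 fun x => (hd' x).continuousAt
  have wronskian : ∀ x, c x * d' x - d x * c' x = 1 / 2 := fun x => by
    simp only [hc_def, hc'_def, hd_def, hd'_def]
    field_simp [hne 0]
    linear_combination u 0 * Real.sin_sq_add_cos_sq (x / 2)
  have N1 := h.integral_jacobi_nonneg hc hc' hcper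
  have N2 := h.integral_jacobi_nonneg hd hd' hdper
  set p : ℝ → ℝ := fun x => c x / u x with hp_def
  set q : ℝ → ℝ := fun x => d x / u x with hq_def
  set a : ℝ → ℝ := fun x => u x * c' x - u' x * c x with ha_def
  set b : ℝ → ℝ := fun x => u x * d' x - u' x * d x with hb_def
  have hp : ∀ x, HasDerivAt p (a x * ((u x) ^ 2)⁻¹) x := h.hasDerivAt_jacobi hc
  have hq : ∀ x, HasDerivAt q (b x * ((u x) ^ 2)⁻¹) x := h.hasDerivAt_jacobi hd
  have ha : ∀ x, HasDerivAt a (-(curv u u'' x * ((u x) ^ 2)⁻¹ * p x) / 4) x :=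
    h.hasDerivAt_jacobi_deriv hc hc'
  have hb : ∀ x, HasDerivAt b (-(curv u u'' x * ((u x) ^ 2)⁻¹ * q x) / 4) x :=
    h.hasDerivAt_jacobi_deriv hd hd'
  have cp : Continuous p := continuous_iff_continuousAt.2 fun x => (hp x).continuousAt
  have cq : Continuous q := continuous_iff_continuousAt.2 fun x => (hq x).continuousAt
  have wpqab : ∀ x, p x * b x - q x * a x = 1 / 2 := fun x => by
    rw [← wronskian x]
    simp only [hp_def, hq_def, ha_def, hb_def]
    have := hne x
    field_simp
    ring
  have p0 : p 0 = 1 := by simp [hp_def, hc_def, hne 0]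
  have q0 : q 0 = 0 := by simp [hq_def, hd_def]
  have a0 : a 0 = 0 := by simp [ha_def, hc_def, hc'_def]; ring
  have b0 : b 0 = 1 / 2 := by simp [hb_def, hd_def, hd'_def]; field_simp [hne 0]
  have pper : Function.Antiperiodic p (2 * π) := fun x => by
    simp only [hp_def, h.periodic x, hcper x, neg_div]
  have qper : Function.Antiperiodic q (2 * π) := fun x => by
    simp only [hq_def, h.periodic x, hdper x, neg_div]
  have aper : Function.Antiperiodic a (2 * π) := fun x => by
    simp only [ha_def, h.periodic x, h.periodic1 x, hcper x, hcper' x]; ring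
  have bper : Function.Antiperiodic b (2 * π) := fun x => by
    simp only [hb_def, h.periodic x, h.periodic1 x, hdper x, hdper' x]; ring
  obtain ⟨h1, h2⟩ := jacobi_norm_sq_bounds cR cw h.weight_pos hp hq ha hb wpqab p0 q0 a0 b0
    pper qper aper bper hH
  refine ⟨fun x => p x ^ 2 + q x ^ 2, by fun_prop, ?_, h1, h2⟩
  have N3 := add_nonneg N1 N2
  rw [← intervalIntegral.integral_add (Continuous.intervalIntegrable (by fun_prop) _ _)
    (Continuous.intervalIntegrable (by fun_prop) _ _)] at N3
  refine N3.trans_eq (intervalIntegral.integral_congr fun x _ => ?_)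
  ring

theorem curvVariance_nonneg (u u'' : ℝ → ℝ) : 0 ≤ curvVariance u u'' :=
  intervalIntegral.integral_nonneg two_pi_pos.le fun _ _ =>
    mul_nonneg (sq_nonneg _) (inv_nonneg.2 (sq_nonneg _))

theorem integral_abs_curv_sub_le (h : NormalizedFactor u u' u'') :
    (∫ x in (0:ℝ)..(2 * π), |curv u u'' x - meanCurv u u''| * ((u x) ^ 2)⁻¹) ^ 2 ≤
      2 * π * curvVariance u u'' := by
  have c0 := h.continuous0
  have cR := h.continuous_curv
  have hne := h.ne_zero
  have hcs := sq_integral_mul_le two_pi_pos.le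
    (f := fun x => |curv u u'' x - meanCurv u u''| * (u x)⁻¹) (g := fun x => (u x)⁻¹)
    (by fun_prop (disch := assumption)) (by fun_prop (disch := assumption))
  simp only [mul_pow, sq_abs, inv_pow, mul_assoc, ← sq] at hcs
  rwa [h.length, mul_comm _ (2 * π)] at hcs

/-- A Łojasiewicz inequality for the total 4-scalar curvature. -/
theorem exists_one_sub_meanCurv_le (D₀ : ℝ) : ∃ C, 0 < C ∧ ∀ u u' u'' : ℝ → ℝ,
    NormalizedFactor u u' u'' → 1 - meanCurv u u'' ≤ D₀ →
      1 - meanCurv u u'' ≤ C * curvVariance u u'' := by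
  set M := Real.exp (2 * π * D₀ + 1) with hM
  have M0 : 0 < M := Real.exp_pos _
  refine ⟨(2 * M + 64 * M ^ 2 * |D₀|) * (2 * π), by positivity, fun u u' u'' h hD => ?_⟩
  set D := 1 - meanCurv u u'' with hDdef
  have D0 : 0 ≤ D := sub_nonneg.2 h.meanCurv_le_one
  have hD0 : 0 ≤ D₀ := D0.trans hD
  have cw := h.continuous_weight
  have cR := h.continuous_curv
  have hwpos := h.weight_pos
  set S := ∫ x in (0:ℝ)..(2 * π), |curv u u'' x - meanCurv u u''| * ((u x) ^ 2)⁻¹ with hS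
  have S0 : 0 ≤ S := intervalIntegral.integral_nonneg two_pi_pos.le fun x _ =>
    mul_nonneg (abs_nonneg _) (hwpos x).le
  have hSF : S ^ 2 ≤ 2 * π * curvVariance u u'' := h.integral_abs_curv_sub_le
  set H := ∫ x in (0:ℝ)..(2 * π), |1 - curv u u'' x| * ((u x) ^ 2)⁻¹ with hH
  have H0 : 0 ≤ H := intervalIntegral.integral_nonneg two_pi_pos.le fun x _ =>
    mul_nonneg (abs_nonneg _) (hwpos x).le
  have HS : H ≤ 2 * π * D + S := by
    have hmono : H ≤ ∫ x in (0:ℝ)..(2 * π),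
        (D * ((u x) ^ 2)⁻¹ + |curv u u'' x - meanCurv u u''| * ((u x) ^ 2)⁻¹) := by
      refine intervalIntegral.integral_mono_on two_pi_pos.le
        (Continuous.intervalIntegrable (by fun_prop) _ _)
        (Continuous.intervalIntegrable (by fun_prop) _ _) fun x _ => ?_
      rw [← add_mul]
      refine mul_le_mul_of_nonneg_right ?_ (hwpos x).le
      have := abs_sub D (curv u u'' x - meanCurv u u'')
      rw [abs_of_nonneg D0] at this
      rwa [show 1 - curv u u'' x = D - (curv u u'' x - meanCurv u u'') by rw [hDdef]; ring]
    rwa [intervalIntegral.integral_add (Continuous.intervalIntegrable (by fun_prop) _ _)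
      (Continuous.intervalIntegrable (by fun_prop) _ _), intervalIntegral.integral_const_mul,
      h.length, mul_comm D] at hmono
  obtain ⟨ξ, cξ, hξ0, hξ1, hξ2⟩ := h.exists_jacobi_norm_sq hH
  have hmean : ∫ x in (0:ℝ)..(2 * π), (curv u u'' x - meanCurv u u'') * ((u x) ^ 2)⁻¹ = 0 := by
    simp only [sub_mul]
    rw [intervalIntegral.integral_sub (Continuous.intervalIntegrable (by fun_prop) _ _)
      (Continuous.intervalIntegrable (by fun_prop) _ _), integral_curv,
      intervalIntegral.integral_const_mul, h.length]
    ring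
  have hle : D * ∫ x in (0:ℝ)..(2 * π), ((u x) ^ 2)⁻¹ * ξ x ≤ 2 * H * Real.exp (H / 2) * S := by
    have e : ∫ x in (0:ℝ)..(2 * π), (curv u u'' x - 1) * ((u x) ^ 2)⁻¹ * ξ x =
        (∫ x in (0:ℝ)..(2 * π),
          (curv u u'' x - meanCurv u u'') * ((u x) ^ 2)⁻¹ * (ξ x - 1)) +
        (∫ x in (0:ℝ)..(2 * π), (curv u u'' x - meanCurv u u'') * ((u x) ^ 2)⁻¹) -
        D * ∫ x in (0:ℝ)..(2 * π), ((u x) ^ 2)⁻¹ * ξ x := by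
      rw [← intervalIntegral.integral_const_mul, ← intervalIntegral.integral_add,
        ← intervalIntegral.integral_sub]
      · refine intervalIntegral.integral_congr fun x _ => ?_
        simp only [hDdef]
        ring
      all_goals exact Continuous.intervalIntegrable (by fun_prop) _ _
    have hb : ∫ x in (0:ℝ)..(2 * π),
          (curv u u'' x - meanCurv u u'') * ((u x) ^ 2)⁻¹ * (ξ x - 1) ≤
        ∫ x in (0:ℝ)..(2 * π), 2 * H * Real.exp (H / 2) *
          (|curv u u'' x - meanCurv u u''| * ((u x) ^ 2)⁻¹) := by
      refine intervalIntegral.integral_mono_on two_pi_pos.le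
        (Continuous.intervalIntegrable (by fun_prop) _ _)
        (Continuous.intervalIntegrable (by fun_prop) _ _) fun x _ => ?_
      refine (le_abs_self _).trans ?_
      rw [abs_mul, abs_mul, abs_of_pos (hwpos x), mul_comm]
      exact mul_le_mul_of_nonneg_right (hξ1 x) (mul_nonneg (abs_nonneg _) (hwpos x).le)
    rw [intervalIntegral.integral_const_mul] at hb
    rw [e, hmean] at hξ0
    linarith
  have hlow : 2 * π ≤ (∫ x in (0:ℝ)..(2 * π), ((u x) ^ 2)⁻¹ * ξ x) * (2 * Real.exp (H / 2)) := by
    have hmono : ∫ x in (0:ℝ)..(2 * π), ((u x) ^ 2)⁻¹ ≤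
        ∫ x in (0:ℝ)..(2 * π), ((u x) ^ 2)⁻¹ * ξ x * (2 * Real.exp (H / 2)) := by
      refine intervalIntegral.integral_mono_on two_pi_pos.le
        (Continuous.intervalIntegrable (by fun_prop) _ _)
        (Continuous.intervalIntegrable (by fun_prop) _ _) fun x _ => ?_
      rw [mul_assoc]
      exact le_mul_of_one_le_right (hwpos x).le (hξ2 x)
    rwa [h.length, intervalIntegral.integral_mul_const] at hmono
  have hkey : π * D ≤ 2 * H * Real.exp H * S := by
    have h1 := mul_le_mul_of_nonneg_left hlow D0
    have h2 := mul_le_mul_of_nonneg_right hle (show 0 ≤ 2 * Real.exp (H / 2) by positivity)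
    have h3 : Real.exp H = Real.exp (H / 2) * Real.exp (H / 2) := by
      rw [← Real.exp_add, add_halves]
    rw [h3]
    linarith
  have hfin : D ≤ (2 * M + 64 * M ^ 2 * D₀) * S ^ 2 := by
    have M1 : 1 ≤ M := Real.one_le_exp (by positivity)
    rcases le_total (8 * M * S) 1 with hsm | hbig
    · have S1 : S ≤ 1 := by nlinarith
      have hexp : Real.exp H ≤ M := Real.exp_le_exp.2 (by nlinarith [pi_pos])
      have h1 : 2 * H * Real.exp H * S ≤ 2 * (2 * π * D + S) * M * S := by gcongr
      have h2 : π * D * (8 * M * S) ≤ π * D * 1 :=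
        mul_le_mul_of_nonneg_left hsm (mul_nonneg pi_pos.le D0)
      have h3 : π * D ≤ 4 * M * S ^ 2 := by linarith
      have h4 : 2 * D ≤ π * D := mul_le_mul_of_nonneg_right two_le_pi D0
      have h5 : 0 ≤ 64 * M ^ 2 * D₀ * S ^ 2 := by positivity
      linarith
    · have h1 : 1 ≤ (8 * M * S) ^ 2 := one_le_pow₀ hbig
      have h2 := mul_le_mul_of_nonneg_left h1 hD0
      have h3 : 0 ≤ 2 * M * S ^ 2 := by positivity
      linarith
  rw [abs_of_nonneg hD0, mul_assoc]
  exact hfin.trans (mul_le_mul_of_nonneg_left hSF (by positivity))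

theorem exists_le_one (h : NormalizedFactor u u' u'') : ∃ p, u p ≤ 1 ∧ ∀ x, u p ≤ u x := by
  obtain ⟨p, hp⟩ := exists_forall_ge_of_periodic h.continuous0 h.periodic
  refine ⟨p, ?_, hp⟩
  by_contra! hcon
  have hmono := intervalIntegral.integral_mono_on two_pi_pos.le
    (h.continuous_weight.intervalIntegrable _ _)
    (continuous_const.intervalIntegrable (μ := volume) 0 (2 * π))
    fun x _ => inv_anti₀ (pow_pos (h.pos p) 2) (pow_le_pow_left₀ (h.pos p).le (hp x) 2)
  rw [h.length, intervalIntegral.integral_const, smul_eq_mul, sub_zero] at hmono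
  have : ((u p) ^ 2)⁻¹ < 1 := inv_lt_one_of_one_lt₀ (one_lt_pow₀ hcon two_ne_zero)
  nlinarith [two_pi_pos]

theorem exists_one_le (h : NormalizedFactor u u' u'') : ∃ p, 1 ≤ u p := by
  obtain ⟨p, hp⟩ := exists_forall_le_of_periodic h.continuous0 h.periodic
  refine ⟨p, ?_⟩
  by_contra! hcon
  have hmono := intervalIntegral.integral_mono_on two_pi_pos.le
    (continuous_const.intervalIntegrable (μ := volume) 0 (2 * π))
    (h.continuous_weight.intervalIntegrable _ _)
    fun x _ => inv_anti₀ (pow_pos (h.pos x) 2) (pow_le_pow_left₀ (h.pos x).le (hp x) 2)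
  rw [h.length, intervalIntegral.integral_const, smul_eq_mul, sub_zero] at hmono
  have : 1 < ((u p) ^ 2)⁻¹ :=
    (one_lt_inv₀ (pow_pos (h.pos p) 2)).2 (pow_lt_one₀ (h.pos p).le hcon two_ne_zero)
  nlinarith [two_pi_pos]

theorem le_and_abs_deriv_le (h : NormalizedFactor u u' u'') {r k : ℝ}
    (hr : r = √(∫ x in (0:ℝ)..(2 * π), curv u u'' x ^ 2 * ((u x) ^ 2)⁻¹))
    (hk : k = √(∫ x in (0:ℝ)..(2 * π), (((u x) ^ 2)⁻¹) ^ 2)) (x : ℝ) :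
    u x ≤ 1 + r * k ∧ 2 * |u' x| ≤ 1 + r * k := by
  have c0 := h.continuous0
  have c1 := h.continuous1
  have c2 := h.continuous2
  have cw := h.continuous_weight
  have cR := h.continuous_curv
  have hne := h.ne_zero
  have rk0 : 0 ≤ r * k := by rw [hr, hk]; positivity
  set G : ℝ → ℝ := fun x => u' x ^ 2 + u x ^ 2 / 4 with hG
  have Gd : ∀ x, HasDerivAt G (u' x * (curv u u'' x * (u x)⁻¹ * ((u x) ^ 2)⁻¹) / 2) x := fun x => by
    refine (((h.deriv2 x).pow 2).add (((h.deriv1 x).pow 2).div_const 4)).congr_deriv ?_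
    have := hne x
    simp only [curv]
    field_simp
    push_cast
    ring
  have Gper : Function.Periodic G (2 * π) := fun x => by
    simp only [hG, h.periodic x, h.periodic1 x]
  have cG : Continuous G := by fun_prop
  obtain ⟨m, hm⟩ := exists_forall_le_of_periodic cG Gper
  obtain ⟨p, hp1, hp⟩ := h.exists_le_one
  have hup : u' p = 0 := (IsLocalMin.hasDerivAt_eq_zero
    (Filter.Eventually.of_forall hp) (h.deriv1 p))
  have hGp : G p ≤ 1 / 4 := by
    simp only [hG, hup]
    nlinarith [h.pos p]
  have Gnonneg : ∀ x, 0 ≤ G x := fun x => by simp only [hG]; positivity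
  set b := √(G m) with hb
  have b0 : 0 ≤ b := Real.sqrt_nonneg _
  have bsq : b ^ 2 = G m := Real.sq_sqrt (Gnonneg m)
  have hub : ∀ x, |u' x| ≤ b := fun x => by
    refine abs_le_of_sq_le_sq ?_ b0
    rw [bsq]
    refine le_trans ?_ (hm x)
    simp only [hG]
    linarith [sq_nonneg (u x)]
  have hle := periodic_le_add_integral Gd (by fun_prop (disch := assumption))
    (g := fun x => b / 2 * (|curv u u'' x| * (u x)⁻¹ * ((u x) ^ 2)⁻¹))
    (by fun_prop (disch := assumption)) Gper (fun x => by
      have h1 : 0 < (u x)⁻¹ := inv_pos.2 (h.pos x)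
      have h2 := h.weight_pos x
      rw [abs_div, abs_mul, abs_mul, abs_mul, abs_of_pos h1, abs_of_pos h2, abs_two]
      have h3 := mul_le_mul_of_nonneg_right (hub x)
        (show 0 ≤ |curv u u'' x| * (u x)⁻¹ * ((u x) ^ 2)⁻¹ by positivity)
      linarith) m p
  have hcs := integral_mul_le_sqrt_mul_sqrt two_pi_pos.le
    (f := fun x => |curv u u'' x| * (u x)⁻¹) (g := fun x => ((u x) ^ 2)⁻¹)
    (by fun_prop (disch := assumption)) cw
  simp only [mul_pow |_|, sq_abs, inv_pow (u _)] at hcs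
  rw [← hr, ← hk] at hcs
  rw [intervalIntegral.integral_const_mul] at hle
  have hbb : b ^ 2 ≤ 1 / 4 + b / 2 * (r * k) := by
    have := mul_le_mul_of_nonneg_left hcs (show 0 ≤ b / 2 by positivity)
    linarith
  have hbfin : 2 * b ≤ 1 + r * k := by
    by_contra! hcon
    nlinarith
  constructor
  · have h1 : u x ^ 2 ≤ (2 * b) ^ 2 := by
      have := hm x
      simp only [hG] at this bsq
      nlinarith [sq_nonneg (u' x)]
    exact (le_of_sq_le_sq h1 (by positivity)).trans hbfin
  · linarith [hub x]

theorem weight_le (h : NormalizedFactor u u' u'') (x : ℝ) :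
    ((u x) ^ 2)⁻¹ ≤ 1 + ∫ s in (0:ℝ)..(2 * π), 2 * (|u' s| * ((u s)⁻¹ * ((u s) ^ 2)⁻¹)) := by
  have c0 := h.continuous0
  have c1 := h.continuous1
  have hne := h.ne_zero
  have hne2 : ∀ x, u x ^ 2 ≠ 0 := fun x => pow_ne_zero 2 (hne x)
  obtain ⟨p, hp⟩ := h.exists_one_le
  have hw : ∀ x, HasDerivAt (fun x => ((u x) ^ 2)⁻¹)
      (-(2 * (u' x * ((u x)⁻¹ * ((u x) ^ 2)⁻¹)))) x := fun x => by
    refine (((h.deriv1 x).pow 2).inv (hne2 x)).congr_deriv ?_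
    have := hne x
    simp only [Pi.pow_apply]
    field_simp
    push_cast
    ring
  have hle := periodic_le_add_integral hw (by fun_prop (disch := assumption))
    (g := fun s => 2 * (|u' s| * ((u s)⁻¹ * ((u s) ^ 2)⁻¹)))
    (by fun_prop (disch := assumption)) (fun x => by simp only [h.periodic x]) (fun x => by
      have h1 : 0 < (u x)⁻¹ * ((u x) ^ 2)⁻¹ := mul_pos (inv_pos.2 (h.pos x)) (h.weight_pos x)
      rw [abs_neg, abs_mul, abs_mul, abs_of_pos h1, abs_two]) x p
  have : ((u p) ^ 2)⁻¹ ≤ 1 := inv_le_one_of_one_le₀ (one_le_pow₀ hp)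
  linarith

theorem integral_curv_sq (h : NormalizedFactor u u' u'') :
    ∫ x in (0:ℝ)..(2 * π), curv u u'' x ^ 2 * ((u x) ^ 2)⁻¹ =
      curvVariance u u'' + 2 * π * meanCurv u u'' ^ 2 := by
  have cw := h.continuous_weight
  have cR := h.continuous_curv
  have e : ∫ x in (0:ℝ)..(2 * π), curv u u'' x ^ 2 * ((u x) ^ 2)⁻¹ = curvVariance u u'' +
      2 * meanCurv u u'' * (∫ x in (0:ℝ)..(2 * π), curv u u'' x * ((u x) ^ 2)⁻¹) -
      meanCurv u u'' ^ 2 * ∫ x in (0:ℝ)..(2 * π), ((u x) ^ 2)⁻¹ := by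
    rw [curvVariance, ← intervalIntegral.integral_const_mul, ← intervalIntegral.integral_const_mul,
      ← intervalIntegral.integral_add, ← intervalIntegral.integral_sub]
    · refine intervalIntegral.integral_congr fun x _ => ?_
      ring
    all_goals exact Continuous.intervalIntegrable (by fun_prop) _ _
  rw [e, integral_curv, h.length]
  ring

theorem sqrt_integral_curv_sq_le (h : NormalizedFactor u u' u'') {D₀ : ℝ}
    (hD : 1 - meanCurv u u'' ≤ D₀) :
    √(∫ x in (0:ℝ)..(2 * π), curv u u'' x ^ 2 * ((u x) ^ 2)⁻¹) ≤
      √(curvVariance u u'') + 3 * (1 + D₀) := by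
  have hm := h.meanCurv_le_one
  have hD₀ : 0 ≤ D₀ := by linarith
  refine Real.sqrt_le_iff.2 ⟨by positivity, ?_⟩
  rw [h.integral_curv_sq, add_sq, Real.sq_sqrt (curvVariance_nonneg u u'')]
  have h1 : meanCurv u u'' ^ 2 ≤ (1 + D₀) ^ 2 := sq_le_sq' (by linarith) (by linarith)
  have h2 : 2 * π * meanCurv u u'' ^ 2 ≤ 9 * (1 + D₀) ^ 2 :=
    mul_le_mul (by linarith [pi_lt_four, pi_lt_d2]) h1 (sq_nonneg _) (by norm_num)
  have h3 : 0 ≤ 2 * √(curvVariance u u'') * (3 * (1 + D₀)) := by positivity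
  linarith

theorem two_pi_le_integral_weight_sq (h : NormalizedFactor u u' u'') :
    2 * π ≤ ∫ x in (0:ℝ)..(2 * π), (((u x) ^ 2)⁻¹) ^ 2 := by
  have hcs := sq_integral_mul_le two_pi_pos.le h.continuous_weight
    (continuous_const (y := (1:ℝ)))
  simp only [mul_one, one_pow] at hcs
  rw [h.length, intervalIntegral.integral_const, smul_eq_mul, sub_zero, mul_one, sq] at hcs
  exact le_of_mul_le_mul_right hcs two_pi_pos

theorem weight_le_mul_integral_weight_sq (h : NormalizedFactor u u' u'') (x : ℝ) :
    ((u x) ^ 2)⁻¹ ≤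
      4 * (1 + √(∫ x in (0:ℝ)..(2 * π), curv u u'' x ^ 2 * ((u x) ^ 2)⁻¹)) *
        ∫ x in (0:ℝ)..(2 * π), (((u x) ^ 2)⁻¹) ^ 2 := by
  have c0 := h.continuous0
  have c1 := h.continuous1
  have hne := h.ne_zero
  have cw := h.continuous_weight
  set r := √(∫ x in (0:ℝ)..(2 * π), curv u u'' x ^ 2 * ((u x) ^ 2)⁻¹) with hr
  set K := ∫ x in (0:ℝ)..(2 * π), (((u x) ^ 2)⁻¹) ^ 2 with hK
  set k := √K with hk
  have hK1 : 1 ≤ K := by linarith [h.two_pi_le_integral_weight_sq, two_le_pi]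
  have hkk : k ^ 2 = K := Real.sq_sqrt (by linarith)
  have hk1 : 1 ≤ k := Real.one_le_sqrt.2 hK1
  have hr0 : 0 ≤ r := Real.sqrt_nonneg _
  have hcs := integral_mul_le_sqrt_mul_sqrt two_pi_pos.le (f := fun x => (u x)⁻¹)
    (g := fun x => ((u x) ^ 2)⁻¹) (by fun_prop (disch := assumption)) cw
  simp only [inv_pow (u _)] at hcs
  rw [h.length, ← hK, ← hk] at hcs
  have h3 : √(2 * π) ≤ 3 := Real.sqrt_le_iff.2 ⟨by norm_num, by linarith [pi_lt_four]⟩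
  have hmono : ∫ s in (0:ℝ)..(2 * π), 2 * (|u' s| * ((u s)⁻¹ * ((u s) ^ 2)⁻¹)) ≤
      ∫ s in (0:ℝ)..(2 * π), (1 + r * k) * ((u s)⁻¹ * ((u s) ^ 2)⁻¹) := by
    refine intervalIntegral.integral_mono_on two_pi_pos.le
      (Continuous.intervalIntegrable (by fun_prop (disch := assumption)) _ _)
      (Continuous.intervalIntegrable (by fun_prop (disch := assumption)) _ _) fun s _ => ?_
    rw [← mul_assoc]
    exact mul_le_mul_of_nonneg_right (h.le_and_abs_deriv_le hr hk s).2
      (mul_pos (inv_pos.2 (h.pos s)) (h.weight_pos s)).le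
  rw [intervalIntegral.integral_const_mul (1 + r * k)] at hmono
  have hw := h.weight_le x
  have h4 : (1 + r * k) * ∫ s in (0:ℝ)..(2 * π), (u s)⁻¹ * ((u s) ^ 2)⁻¹ ≤
      (1 + r * k) * (3 * k) := by
    gcongr
    exact hcs.trans (by gcongr)
  rw [← hkk]
  nlinarith [mul_nonneg hr0 (sq_nonneg k)]

theorem neg_integral_curv_sub_mul_weight_sq_le (h : NormalizedFactor u u' u'') {D₀ : ℝ}
    (hD : 1 - meanCurv u u'' ≤ D₀) :
    -∫ x in (0:ℝ)..(2 * π), (curv u u'' x - meanCurv u u'') * (((u x) ^ 2)⁻¹) ^ 2 ≤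
      2 * (4 + 3 * D₀) * (√(curvVariance u u'') + curvVariance u u'') *
        ∫ x in (0:ℝ)..(2 * π), (((u x) ^ 2)⁻¹) ^ 2 := by
  have c0 := h.continuous0
  have cR := h.continuous_curv
  have hne := h.ne_zero
  have cw := h.continuous_weight
  have hm := h.meanCurv_le_one
  have hD₀ : 0 ≤ D₀ := by linarith
  have hr := h.sqrt_integral_curv_sq_le hD
  have hw := h.weight_le_mul_integral_weight_sq
  set r := √(∫ x in (0:ℝ)..(2 * π), curv u u'' x ^ 2 * ((u x) ^ 2)⁻¹)
  have hr0 : 0 ≤ r := Real.sqrt_nonneg _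
  set K := ∫ x in (0:ℝ)..(2 * π), (((u x) ^ 2)⁻¹) ^ 2 with hK
  have hK0 : 0 ≤ K := by linarith [h.two_pi_le_integral_weight_sq, two_le_pi]
  have hcs := integral_mul_le_sqrt_mul_sqrt two_pi_pos.le
    (f := fun x => -(curv u u'' x - meanCurv u u'') * (u x)⁻¹)
    (g := fun x => (u x)⁻¹ * ((u x) ^ 2)⁻¹) (by fun_prop (disch := assumption))
    (by fun_prop (disch := assumption))
  have e1 : ∫ x in (0:ℝ)..(2 * π), -(curv u u'' x - meanCurv u u'') * (u x)⁻¹ *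
      ((u x)⁻¹ * ((u x) ^ 2)⁻¹) =
      -∫ x in (0:ℝ)..(2 * π), (curv u u'' x - meanCurv u u'') * (((u x) ^ 2)⁻¹) ^ 2 := by
    rw [← intervalIntegral.integral_neg]
    refine intervalIntegral.integral_congr fun x _ => ?_
    simp only [← inv_pow (u _)]
    ring
  have e2 : ∫ x in (0:ℝ)..(2 * π), (-(curv u u'' x - meanCurv u u'') * (u x)⁻¹) ^ 2 =
      curvVariance u u'' := by
    refine intervalIntegral.integral_congr fun x _ => ?_
    simp only [← inv_pow (u _)]
    ring
  have e3 : √(∫ x in (0:ℝ)..(2 * π), ((u x)⁻¹ * ((u x) ^ 2)⁻¹) ^ 2) ≤ 2 * (1 + r) * K := by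
    refine Real.sqrt_le_iff.2 ⟨by positivity, ?_⟩
    have hmono : ∫ x in (0:ℝ)..(2 * π), ((u x)⁻¹ * ((u x) ^ 2)⁻¹) ^ 2 ≤
        ∫ x in (0:ℝ)..(2 * π), 4 * (1 + r) * K * (((u x) ^ 2)⁻¹) ^ 2 := by
      refine intervalIntegral.integral_mono_on two_pi_pos.le
        (Continuous.intervalIntegrable (by fun_prop (disch := assumption)) _ _)
        (Continuous.intervalIntegrable (by fun_prop) _ _) fun x _ => ?_
      rw [mul_pow, inv_pow (u x)]
      exact mul_le_mul_of_nonneg_right (hw x) (sq_nonneg _)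
    rw [intervalIntegral.integral_const_mul] at hmono
    refine hmono.trans ?_
    rw [← hK]
    nlinarith [mul_nonneg hr0 (sq_nonneg K), mul_nonneg (mul_nonneg hr0 hr0) (sq_nonneg K)]
  rw [e1, e2] at hcs
  have hF := Real.sq_sqrt (curvVariance_nonneg u u'')
  set s := √(curvVariance u u'')
  have s0 : 0 ≤ s := Real.sqrt_nonneg _
  calc _ ≤ s * (2 * (1 + r) * K) := hcs.trans (by gcongr)
    _ ≤ s * (2 * (1 + (s + 3 * (1 + D₀))) * K) := by gcongr
    _ ≤ 2 * (4 + 3 * D₀) * (s + curvVariance u u'') * K := by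
      rw [← hF]
      have hsK := mul_nonneg (mul_nonneg s0 s0) hK0
      nlinarith [mul_nonneg hD₀ hsK]

theorem four_mul_integral_deriv_sq_le (h : NormalizedFactor u u' u'') {D₀ : ℝ}
    (hD : 1 - meanCurv u u'' ≤ D₀) :
    4 * ∫ x in (0:ℝ)..(2 * π), u' x ^ 2 ≤ (∫ x in (0:ℝ)..(2 * π), u x ^ 2) + 2 * π * D₀ := by
  have c0 := h.continuous0
  have c1 := h.continuous1
  have e := h.integral_curv_eq
  rw [integral_curv, intervalIntegral.integral_sub
    (Continuous.intervalIntegrable (by fun_prop) _ _)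
    (Continuous.intervalIntegrable (by fun_prop) _ _), intervalIntegral.integral_const_mul] at e
  nlinarith [pi_pos]

theorem sq_le_mul_integral_sq (h : NormalizedFactor u u' u'') {D₀ : ℝ}
    (hD : 1 - meanCurv u u'' ≤ D₀) (x : ℝ) :
    u x ^ 2 ≤ (2 + π + 2 * π ^ 2 * D₀) * ((∫ x in (0:ℝ)..(2 * π), u x ^ 2) + 1) := by
  have c0 := h.continuous0
  have c1 := h.continuous1
  have hm := h.meanCurv_le_one
  have hD₀ : 0 ≤ D₀ := by linarith
  obtain ⟨p, hp, -⟩ := h.exists_le_one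
  have hle := periodic_le_add_integral h.deriv1 c1 (g := fun x => |u' x|) (by fun_prop) h.periodic
    (fun _ => le_rfl) x p
  have hcs := sq_integral_mul_le two_pi_pos.le (f := fun x => |u' x|) (by fun_prop)
    (continuous_const (y := (1:ℝ)))
  simp only [mul_one, one_pow, sq_abs] at hcs
  rw [intervalIntegral.integral_const, smul_eq_mul, sub_zero, mul_one] at hcs
  have hI := h.four_mul_integral_deriv_sq_le hD
  have hy : 0 ≤ ∫ x in (0:ℝ)..(2 * π), u x ^ 2 :=
    intervalIntegral.integral_nonneg two_pi_pos.le fun _ _ => sq_nonneg _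
  set a := ∫ x in (0:ℝ)..(2 * π), |u' x|
  set y := ∫ x in (0:ℝ)..(2 * π), u x ^ 2
  have h1 : u x ^ 2 ≤ (1 + a) ^ 2 := pow_le_pow_left₀ (h.pos x).le (by linarith) 2
  have h2 := mul_le_mul_of_nonneg_left hI pi_pos.le
  have h3 : 0 ≤ 2 * y + 2 * π ^ 2 * D₀ * y := by positivity
  nlinarith [sq_nonneg (1 - a), pi_pos]

theorem half_integral_curv_sub_mul_sq_le (h : NormalizedFactor u u' u'') {D₀ k₀ : ℝ}
    (hD : 1 - meanCurv u u'' ≤ D₀) (hk₀ : 1 ≤ k₀)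
    (hk : √(∫ x in (0:ℝ)..(2 * π), (((u x) ^ 2)⁻¹) ^ 2) ≤ k₀) :
    1 / 2 * ∫ x in (0:ℝ)..(2 * π), (curv u u'' x - meanCurv u u'') * u x ^ 2 ≤
      1 / 2 * k₀ * √(2 + π + 2 * π ^ 2 * D₀) * (4 + 3 * D₀) *
        (√(curvVariance u u'') + curvVariance u u'') *
        ((∫ x in (0:ℝ)..(2 * π), u x ^ 2) + 1) := by
  have c0 := h.continuous0
  have cR := h.continuous_curv
  have hne := h.ne_zero
  have hm := h.meanCurv_le_one
  have hD₀ : 0 ≤ D₀ := by linarith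
  have hr := h.sqrt_integral_curv_sq_le hD
  have hu := fun x => (h.le_and_abs_deriv_le rfl rfl x).1
  have hy := h.sq_le_mul_integral_sq hD
  have hy0 : 0 ≤ ∫ x in (0:ℝ)..(2 * π), u x ^ 2 :=
    intervalIntegral.integral_nonneg two_pi_pos.le fun _ _ => sq_nonneg _
  have hB := Real.sq_sqrt (show 0 ≤ 2 + π + 2 * π ^ 2 * D₀ by positivity)
  set b := √(2 + π + 2 * π ^ 2 * D₀)
  have b0 : 0 ≤ b := Real.sqrt_nonneg _
  rw [← hB] at hy
  set r := √(∫ x in (0:ℝ)..(2 * π), curv u u'' x ^ 2 * ((u x) ^ 2)⁻¹)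
  have hr0 : 0 ≤ r := Real.sqrt_nonneg _
  set k := √(∫ x in (0:ℝ)..(2 * π), (((u x) ^ 2)⁻¹) ^ 2)
  have k0 : 0 ≤ k := Real.sqrt_nonneg _
  set y := ∫ x in (0:ℝ)..(2 * π), u x ^ 2 with hydef
  have hcs := integral_mul_le_sqrt_mul_sqrt two_pi_pos.le
    (f := fun x => (curv u u'' x - meanCurv u u'') * (u x)⁻¹)
    (g := fun x => u x ^ 3) (by fun_prop (disch := assumption)) (by fun_prop)
  have e1 : ∫ x in (0:ℝ)..(2 * π), (curv u u'' x - meanCurv u u'') * (u x)⁻¹ * u x ^ 3 =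
      ∫ x in (0:ℝ)..(2 * π), (curv u u'' x - meanCurv u u'') * u x ^ 2 := by
    refine intervalIntegral.integral_congr fun x _ => ?_
    have := hne x
    field_simp
  have e2 : ∫ x in (0:ℝ)..(2 * π), ((curv u u'' x - meanCurv u u'') * (u x)⁻¹) ^ 2 =
      curvVariance u u'' := by
    refine intervalIntegral.integral_congr fun x _ => ?_
    simp only [← inv_pow (u _)]
    ring
  have e3 : √(∫ x in (0:ℝ)..(2 * π), (u x ^ 3) ^ 2) ≤ (1 + r * k) * b * (y + 1) := by
    refine Real.sqrt_le_iff.2 ⟨by positivity, ?_⟩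
    have hmono : ∫ x in (0:ℝ)..(2 * π), (u x ^ 3) ^ 2 ≤
        ∫ x in (0:ℝ)..(2 * π), (1 + r * k) ^ 2 * (b ^ 2 * (y + 1)) * u x ^ 2 := by
      refine intervalIntegral.integral_mono_on two_pi_pos.le
        (Continuous.intervalIntegrable (by fun_prop) _ _)
        (Continuous.intervalIntegrable (by fun_prop) _ _) fun x _ => ?_
      rw [show (u x ^ 3) ^ 2 = u x ^ 2 * u x ^ 2 * u x ^ 2 by ring]
      have := pow_le_pow_left₀ (h.pos x).le (hu x) 2
      gcongr
      exact hy x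
    rw [intervalIntegral.integral_const_mul] at hmono
    refine hmono.trans ?_
    rw [← hydef]
    have : 0 ≤ (1 + r * k) ^ 2 * (b ^ 2 * (y + 1)) := by positivity
    nlinarith
  rw [e1, e2] at hcs
  have hF := Real.sq_sqrt (curvVariance_nonneg u u'')
  set s := √(curvVariance u u'')
  have s0 : 0 ≤ s := Real.sqrt_nonneg _
  have hrk : 1 + r * k ≤ k₀ * (1 + (s + 3 * (1 + D₀))) := by
    have : r * k ≤ (s + 3 * (1 + D₀)) * k₀ := by gcongr
    linarith
  have hfac : s * (1 + (s + 3 * (1 + D₀))) ≤ (4 + 3 * D₀) * (s + curvVariance u u'') := by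
    rw [← hF]
    nlinarith [mul_nonneg hD₀ (mul_nonneg s0 s0)]
  calc _ ≤ 1 / 2 * (s * ((1 + r * k) * b * (y + 1))) := by
        gcongr
        exact hcs.trans (by gcongr)
    _ ≤ 1 / 2 * (s * (k₀ * (1 + (s + 3 * (1 + D₀))) * b * (y + 1))) := by gcongr
    _ = 1 / 2 * k₀ * b * (s * (1 + (s + 3 * (1 + D₀)))) * (y + 1) := by ring
    _ ≤ 1 / 2 * k₀ * b * ((4 + 3 * D₀) * (s + curvVariance u u'')) * (y + 1) := by gcongr
    _ = _ := by ring

theorem inv_le (h : NormalizedFactor u u' u'') {D₀ : ℝ} (hD : 1 - meanCurv u u'' ≤ D₀) (x : ℝ) :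
    (u x)⁻¹ ≤ 1 + √((∫ x in (0:ℝ)..(2 * π), u x ^ 2) + 2 * π * D₀) *
      √(∫ x in (0:ℝ)..(2 * π), (((u x) ^ 2)⁻¹) ^ 2) := by
  have c0 := h.continuous0
  have c1 := h.continuous1
  have hne := h.ne_zero
  have cw := h.continuous_weight
  obtain ⟨p, -, hp⟩ := h.exists_le_one
  refine (inv_anti₀ (h.pos p) (hp x)).trans ?_
  have hw := h.weight_le p
  have hI := Real.sqrt_le_sqrt (h.four_mul_integral_deriv_sq_le hD)
  set j := √((∫ x in (0:ℝ)..(2 * π), u x ^ 2) + 2 * π * D₀)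
  set K := ∫ x in (0:ℝ)..(2 * π), (((u x) ^ 2)⁻¹) ^ 2 with hK
  set Z := (u p)⁻¹ with hZ
  have Z0 : 0 < Z := inv_pos.2 (h.pos p)
  have hcs := integral_mul_le_sqrt_mul_sqrt two_pi_pos.le (f := fun x => 2 * |u' x|)
    (g := fun x => (u x)⁻¹ * ((u x) ^ 2)⁻¹) (by fun_prop) (by fun_prop (disch := assumption))
  simp only [mul_pow (2 : ℝ), sq_abs, mul_assoc] at hcs
  rw [show (2:ℝ) ^ 2 = 4 by norm_num, intervalIntegral.integral_const_mul 4] at hcs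
  have e3 : √(∫ x in (0:ℝ)..(2 * π), ((u x)⁻¹ * ((u x) ^ 2)⁻¹) ^ 2) ≤ Z * √K := by
    rw [← Real.sqrt_sq Z0.le, ← Real.sqrt_mul (sq_nonneg Z), hK,
      ← intervalIntegral.integral_const_mul]
    refine Real.sqrt_le_sqrt (intervalIntegral.integral_mono_on two_pi_pos.le
      (Continuous.intervalIntegrable (by fun_prop (disch := assumption)) _ _)
      (Continuous.intervalIntegrable (by fun_prop) _ _) fun x _ => ?_)
    rw [mul_pow]
    gcongr
    · exact (inv_pos.2 (h.pos x)).le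
    · exact inv_anti₀ (h.pos p) (hp x)
  have hj0 : 0 ≤ j := Real.sqrt_nonneg _
  have hfin : Z ^ 2 ≤ 1 + j * (Z * √K) := by
    rw [hZ, inv_pow]
    refine hw.trans (add_le_add_right (hcs.trans ?_) 1)
    gcongr
  have hjk : 0 ≤ j * √K := by positivity
  by_contra! hcon
  nlinarith

end NormalizedFactor

theorem le_of_hasDerivAt_nonpos {f f' : ℝ → ℝ} (hf : ∀ t, 0 ≤ t → HasDerivAt f (f' t) t)
    (hf' : ∀ t, 0 ≤ t → f' t ≤ 0) {t : ℝ} (ht : 0 ≤ t) : f t ≤ f 0 := by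
  refine antitoneOn_of_deriv_nonpos (convex_Ici 0)
    (fun s hs => (hf s hs).continuousAt.continuousWithinAt) (fun s hs => ?_) (fun s hs => ?_)
    Set.self_mem_Ici ht ht
  · exact (hf s (interior_subset hs)).differentiableAt.differentiableWithinAt
  · rw [(hf s (interior_subset hs)).deriv]
    exact hf' s (interior_subset hs)

/-- If `D` decays by the gradient-type inequality `D ≤ C F`, `D' = -c F`, then `√F` is integrable
in time, hence a quantity growing at relative rate at most `A (√F + F)` stays bounded. -/
theorem exists_forall_le_of_deriv_le_sqrt_add {D F Y Y' : ℝ → ℝ} {c C A : ℝ} (hc : 0 < c)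
    (hC : 0 < C) (hA : 0 ≤ A) (hD : ∀ t, 0 ≤ t → HasDerivAt D (-(c * F t)) t)
    (hF : ∀ t, 0 ≤ t → 0 ≤ F t) (hD0 : ∀ t, 0 ≤ t → 0 ≤ D t) (hDF : ∀ t, 0 ≤ t → D t ≤ C * F t)
    (hY : ∀ t, 0 ≤ t → HasDerivAt Y (Y' t) t) (hY0 : ∀ t, 0 ≤ t → 0 < Y t)
    (hY' : ∀ t, 0 ≤ t → Y' t ≤ A * (√(F t) + F t) * Y t) :
    ∃ B, ∀ t, 0 ≤ t → Y t ≤ B := by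
  set q := √C with hq
  have q0 : 0 < q := Real.sqrt_pos.2 hC
  have qq : q ^ 2 = C := Real.sq_sqrt hC.le
  refine ⟨Real.exp (Real.log (Y 0) + 4 * q * A / c * √(D 0 + 1) + A / c * D 0 + A / q),
    fun T hT => ?_⟩
  set e := 1 / (1 + T) with he
  have e0 : 0 < e := by positivity
  have e1 : e ≤ 1 := (div_le_one (by positivity)).2 (by linarith)
  have eT : e * T ≤ 1 := by
    rw [he, div_mul_eq_mul_div, div_le_one (by positivity)]
    linarith
  have hpos : ∀ t, 0 ≤ t → 0 < D t + e ^ 2 := fun t ht => add_pos_of_nonneg_of_pos (hD0 t ht)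
    (pow_pos e0 2)
  have hle := le_of_hasDerivAt_nonpos
    (f := fun t => Real.log (Y t) + 4 * q * A / c * √(D t + e ^ 2) + A / c * D t - A / q * e * t)
    (fun t ht => ((((hY t ht).log (hY0 t ht).ne').add
      ((((hD t ht).add_const (e ^ 2)).sqrt (hpos t ht).ne').const_mul (4 * q * A / c))).add
      ((hD t ht).const_mul (A / c))).sub ((hasDerivAt_id t).const_mul (A / q * e)))
    (fun t ht => ?_) hT
  · have h1 : √(D T + e ^ 2) ≥ 0 := Real.sqrt_nonneg _
    have h2 : √(D 0 + e ^ 2) ≤ √(D 0 + 1) :=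
      Real.sqrt_le_sqrt (add_le_add_right (pow_le_one₀ e0.le e1) _)
    have h3 : 4 * q * A / c * √(D 0 + e ^ 2) ≤ 4 * q * A / c * √(D 0 + 1) := by gcongr
    have h4 : 0 ≤ 4 * q * A / c * √(D T + e ^ 2) := by positivity
    have h5 : 0 ≤ A / c * D T := mul_nonneg (by positivity) (hD0 T hT)
    have h6 : A / q * (e * T) ≤ A / q * 1 := by gcongr
    rw [← Real.exp_log (hY0 T hT)]
    refine Real.exp_le_exp.2 ?_
    linarith
  · have hs := Real.sq_sqrt (hF t ht)
    have hlog : Y' t / Y t ≤ A * (√(F t) + F t) := (div_le_iff₀ (hY0 t ht)).2 (hY' t ht)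
    set s := √(F t)
    have s0 : 0 ≤ s := Real.sqrt_nonneg _
    set d := √(D t + e ^ 2) with hd
    have d0 : 0 < d := Real.sqrt_pos.2 (hpos t ht)
    have hdle : d ≤ q * s + e := by
      refine Real.sqrt_le_iff.2 ⟨by positivity, ?_⟩
      have : 0 ≤ q * s * e := by positivity
      have h2 := hDF t ht
      rw [← hs, ← qq] at h2
      linarith
    have hsle : s ≤ 2 * q * s ^ 2 / d + e / q := by
      rcases le_total e (q * s) with hes | hes
      · have : s ≤ 2 * q * s ^ 2 / d := by
          rw [le_div_iff₀ d0]
          nlinarith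
        have : 0 ≤ e / q := by positivity
        linarith
      · have : s ≤ e / q := by
          rw [le_div_iff₀ q0]
          linarith
        have : 0 ≤ 2 * q * s ^ 2 / d := by positivity
        linarith
    have hmain := mul_le_mul_of_nonneg_left hsle hA
    have e1 : 4 * q * A / c * (-(c * F t) / (2 * d)) = -(A * (2 * q * s ^ 2 / d)) := by
      rw [hs]
      field_simp
      ring
    have e2 : A / c * -(c * F t) = -(A * F t) := by field_simp
    have e3 : A / q * e * 1 = A * (e / q) := by ring
    simp only [e1, e2, e3]
    linarith

theorem hasDerivAt_integral_of_continuous {F F' : ℝ → ℝ → ℝ} {a b : ℝ}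
    (cF : Continuous fun p : ℝ × ℝ => F p.1 p.2) (cF' : Continuous fun p : ℝ × ℝ => F' p.1 p.2)
    (hF : ∀ x t, HasDerivAt (fun t => F x t) (F' x t) t) (t : ℝ) :
    HasDerivAt (fun t => ∫ x in a..b, F x t) (∫ x in a..b, F' x t) t := by
  obtain ⟨B, hB⟩ := (isCompact_uIcc (a := a) (b := b)).prod (isCompact_closedBall t 1)
    |>.exists_bound_of_continuousOn cF'.continuousOn
  have hsec : ∀ s, Continuous fun x => F x s := fun s => cF.comp (by fun_prop : Continuous
    fun x : ℝ => (x, s))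
  have hsec' : Continuous fun x => F' x t := cF'.comp (by fun_prop : Continuous
    fun x : ℝ => (x, t))
  exact (intervalIntegral.hasDerivAt_integral_of_dominated_loc_of_deriv_le
    (F := fun t x => F x t) (F' := fun t x => F' x t) (bound := fun _ => B)
    (Metric.closedBall_mem_nhds t one_pos)
    (Filter.Eventually.of_forall fun s => (hsec s).aestronglyMeasurable)
    ((hsec t).intervalIntegrable _ _) hsec'.aestronglyMeasurable
    (Filter.Eventually.of_forall fun x hx s hs => hB (x, s) ⟨Set.uIoc_subset_uIcc hx, hs⟩)
    (continuous_const.intervalIntegrable _ _)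
    (Filter.Eventually.of_forall fun x _ s _ => hF x s)).2

theorem hasDerivAt_fst_of_differentiable {G : ℝ × ℝ → ℝ} (hG : Differentiable ℝ G) (x t : ℝ) :
    HasDerivAt (fun x => G (x, t)) (fderiv ℝ G (x, t) (1, 0)) x :=
  (hG (x, t)).hasFDerivAt.comp_hasDerivAt x ((hasDerivAt_id x).prodMk (hasDerivAt_const x t))

theorem hasDerivAt_snd_of_differentiable {G : ℝ × ℝ → ℝ} (hG : Differentiable ℝ G) (x t : ℝ) :
    HasDerivAt (fun t => G (x, t)) (fderiv ℝ G (x, t) (0, 1)) t :=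
  (hG (x, t)).hasFDerivAt.comp_hasDerivAt t ((hasDerivAt_const t x).prodMk (hasDerivAt_id t))

theorem fderiv_fderiv_apply_comm {G : ℝ × ℝ → ℝ} (hG : ContDiff ℝ (⊤ : ℕ∞) G) (p v w : ℝ × ℝ) :
    fderiv ℝ (fun p => fderiv ℝ G p v) p w = fderiv ℝ (fun p => fderiv ℝ G p w) p v := by
  have hd : DifferentiableAt ℝ (fderiv ℝ G) p :=
    (hG.fderiv_right (m := 1) (by norm_cast)).differentiable one_ne_zero p
  have key : ∀ v w, fderiv ℝ (fun p => fderiv ℝ G p v) p w = fderiv ℝ (fderiv ℝ G) p w v := by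
    intro v w
    rw [fderiv_clm_apply hd (differentiableAt_const v)]
    simp
  rw [key, key]
  exact ((contDiff_infty.1 hG 2).contDiffAt.isSymmSndFDerivAt (by simp)).eq w v

/-- A solution `u` of the normalized Yamabe flow on `S¹` for nonnegative times, with its
derivatives. -/
structure NormalizedFlow (u u₁ u₂ uₜ u₁ₜ : ℝ → ℝ → ℝ) : Prop where
  continuous0 : Continuous fun p : ℝ × ℝ => u p.1 p.2
  continuous1 : Continuous fun p : ℝ × ℝ => u₁ p.1 p.2
  continuous_t : Continuous fun p : ℝ × ℝ => uₜ p.1 p.2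
  continuous_1t : Continuous fun p : ℝ × ℝ => u₁ₜ p.1 p.2
  deriv_t : ∀ x t, HasDerivAt (fun t => u x t) (uₜ x t) t
  deriv_1t : ∀ x t, HasDerivAt (fun t => u₁ x t) (u₁ₜ x t) t
  deriv_t1 : ∀ x t, HasDerivAt (fun x => uₜ x t) (u₁ₜ x t) x
  pos : ∀ x t, 0 < u x t
  factor : ∀ t, 0 ≤ t → NormalizedFactor (fun x => u x t) (fun x => u₁ x t) (fun x => u₂ x t)
  flow : ∀ x t, 0 ≤ t → uₜ x t = 1 / 4 * (curv (fun x => u x t) (fun x => u₂ x t) x -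
    meanCurv (fun x => u x t) (fun x => u₂ x t)) * u x t

namespace NormalizedFlow

variable {u u₁ u₂ uₜ u₁ₜ : ℝ → ℝ → ℝ}

theorem hasDerivAt_integral_sq_sub (h : NormalizedFlow u u₁ u₂ uₜ u₁ₜ) {t : ℝ} (ht : 0 ≤ t) :
    HasDerivAt (fun t => ∫ x in (0:ℝ)..(2 * π), (u x t ^ 2 - 4 * u₁ x t ^ 2))
      (1 / 2 * curvVariance (fun x => u x t) (fun x => u₂ x t)) t := by
  have c0 := h.continuous0
  have c1 := h.continuous1
  have ct := h.continuous_t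
  have c1t := h.continuous_1t
  have hN := h.factor t ht
  have hd := hasDerivAt_integral_of_continuous (a := 0) (b := 2 * π)
    (F := fun x t => u x t ^ 2 - 4 * u₁ x t ^ 2)
    (F' := fun x t => 2 * u x t * uₜ x t - 8 * (u₁ x t * u₁ₜ x t)) (by fun_prop) (by fun_prop)
    (fun x t => (((h.deriv_t x t).pow 2).sub (((h.deriv_1t x t).pow 2).const_mul 4)).congr_deriv
      (by push_cast; ring)) t
  refine hd.congr_deriv ?_
  have s1 : Continuous fun x => u₁ x t := hN.continuous1
  have s2 : Continuous fun x => u₂ x t := hN.continuous2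
  have st : Continuous fun x => uₜ x t := ct.comp (by fun_prop : Continuous fun x : ℝ => (x, t))
  have s1t : Continuous fun x => u₁ₜ x t := c1t.comp (by fun_prop : Continuous fun x : ℝ => (x, t))
  have cw := hN.continuous_weight
  have cR := hN.continuous_curv
  have hper := hN.periodic
  have hper1 := hN.periodic1
  have hper2 := hN.periodic2
  have hparts : ∫ x in (0:ℝ)..(2 * π), (u₂ x t * uₜ x t + u₁ x t * u₁ₜ x t) = 0 :=
    integral_deriv_eq_zero_of_periodic (f := fun x => u₁ x t * uₜ x t)
      (fun x => (hN.deriv2 x).mul (h.deriv_t1 x t)) (by fun_prop) fun x => by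
        simp only [h.flow _ t ht, curv, hper x, hper1 x, hper2 x]
  have hmean := integral_curv (fun x => u x t) (fun x => u₂ x t)
  have hlen := hN.length
  have hflow := fun x => h.flow x t ht
  set R := curv (fun x => u x t) (fun x => u₂ x t) with hR
  set m := meanCurv (fun x => u x t) (fun x => u₂ x t) with hm
  have e : ∫ x in (0:ℝ)..(2 * π), (2 * u x t * uₜ x t - 8 * (u₁ x t * u₁ₜ x t)) =
      1 / 2 * curvVariance (fun x => u x t) (fun x => u₂ x t) +
      1 / 2 * m * (∫ x in (0:ℝ)..(2 * π), R x * (u x t ^ 2)⁻¹) -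
      1 / 2 * m ^ 2 * (∫ x in (0:ℝ)..(2 * π), (u x t ^ 2)⁻¹) -
      8 * ∫ x in (0:ℝ)..(2 * π), (u₂ x t * uₜ x t + u₁ x t * u₁ₜ x t) := by
    rw [curvVariance, ← hR, ← hm]
    simp only [← intervalIntegral.integral_const_mul]
    rw [← intervalIntegral.integral_add, ← intervalIntegral.integral_sub,
      ← intervalIntegral.integral_sub]
    · refine intervalIntegral.integral_congr fun x _ => ?_
      have hx := (h.pos x t).ne'
      have hRx : R x * (u x t ^ 2)⁻¹ = u x t * (4 * u₂ x t + u x t) := by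
        simp only [hR, curv]
        field_simp
      simp only [hflow]
      linear_combination (1 / 2 * (m - R x)) * hRx
    all_goals exact Continuous.intervalIntegrable (by fun_prop) _ _
  rw [e, hparts, hmean, hlen]
  ring

theorem hasDerivAt_integral_weight_sq (h : NormalizedFlow u u₁ u₂ uₜ u₁ₜ) {t : ℝ} (ht : 0 ≤ t) :
    HasDerivAt (fun t => ∫ x in (0:ℝ)..(2 * π), ((u x t ^ 2)⁻¹) ^ 2)
      (-∫ x in (0:ℝ)..(2 * π), (curv (fun x => u x t) (fun x => u₂ x t) x -
        meanCurv (fun x => u x t) (fun x => u₂ x t)) * ((u x t ^ 2)⁻¹) ^ 2) t := by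
  have c0 := h.continuous0
  have ct := h.continuous_t
  have hne : ∀ p : ℝ × ℝ, u p.1 p.2 ≠ 0 := fun p => (h.pos p.1 p.2).ne'
  have hne2 : ∀ p : ℝ × ℝ, u p.1 p.2 ^ 2 ≠ 0 := fun p => pow_ne_zero 2 (hne p)
  have hd := hasDerivAt_integral_of_continuous (a := 0) (b := 2 * π)
    (F := fun x t => ((u x t ^ 2)⁻¹) ^ 2)
    (F' := fun x t => -4 * uₜ x t * (u x t)⁻¹ * ((u x t ^ 2)⁻¹) ^ 2)
    (by fun_prop (disch := assumption)) (by fun_prop (disch := assumption))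
    (fun x t => ((((h.deriv_t x t).pow 2).inv (hne2 (x, t))).pow 2).congr_deriv (by
      have := (h.pos x t).ne'
      simp only [Pi.pow_apply, Pi.inv_apply]
      push_cast
      field_simp
      norm_num
      ring)) t
  refine hd.congr_deriv ?_
  rw [← intervalIntegral.integral_neg]
  refine intervalIntegral.integral_congr fun x _ => ?_
  have := (h.pos x t).ne'
  simp only [h.flow x t ht]
  field_simp

theorem hasDerivAt_integral_sq (h : NormalizedFlow u u₁ u₂ uₜ u₁ₜ) {t : ℝ} (ht : 0 ≤ t) :
    HasDerivAt (fun t => ∫ x in (0:ℝ)..(2 * π), u x t ^ 2)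
      (1 / 2 * ∫ x in (0:ℝ)..(2 * π), (curv (fun x => u x t) (fun x => u₂ x t) x -
        meanCurv (fun x => u x t) (fun x => u₂ x t)) * u x t ^ 2) t := by
  have c0 := h.continuous0
  have ct := h.continuous_t
  have hd := hasDerivAt_integral_of_continuous (a := 0) (b := 2 * π)
    (F := fun x t => u x t ^ 2) (F' := fun x t => 2 * u x t * uₜ x t) (by fun_prop) (by fun_prop)
    (fun x t => ((h.deriv_t x t).pow 2).congr_deriv (by push_cast; ring)) t
  refine hd.congr_deriv ?_
  rw [← intervalIntegral.integral_const_mul]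
  refine intervalIntegral.integral_congr fun x _ => ?_
  simp only [h.flow x t ht]
  ring

theorem exists_bound (h : NormalizedFlow u u₁ u₂ uₜ u₁ₜ) :
    ∃ B, ∀ x t, 0 ≤ t → (u x t)⁻¹ ≤ B ∧ u x t ≤ B := by
  set D : ℝ → ℝ := fun t => 1 - (∫ x in (0:ℝ)..(2 * π), (u x t ^ 2 - 4 * u₁ x t ^ 2)) / (2 * π)
    with hDdef
  set F : ℝ → ℝ := fun t => curvVariance (fun x => u x t) (fun x => u₂ x t) with hFdef
  have hDm : ∀ t, 0 ≤ t → D t = 1 - meanCurv (fun x => u x t) (fun x => u₂ x t) := fun t ht => by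
    simp only [hDdef, ← (h.factor t ht).integral_curv_eq, meanCurv]
  have hD' : ∀ t, 0 ≤ t → HasDerivAt D (-(1 / (4 * π) * F t)) t := fun t ht =>
    (((h.hasDerivAt_integral_sq_sub ht).div_const (2 * π)).const_sub 1).congr_deriv (by
      simp only [hFdef]
      field_simp
      ring)
  have hF0 : ∀ t, 0 ≤ t → 0 ≤ F t := fun t _ => NormalizedFactor.curvVariance_nonneg _ _
  have hD0 : ∀ t, 0 ≤ t → 0 ≤ D t := fun t ht => by
    rw [hDm t ht]
    exact sub_nonneg.2 (h.factor t ht).meanCurv_le_one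
  have hDle : ∀ t, 0 ≤ t → 1 - meanCurv (fun x => u x t) (fun x => u₂ x t) ≤ D 0 := fun t ht => by
    rw [← hDm t ht]
    exact le_of_hasDerivAt_nonpos hD'
      (fun t ht => neg_nonpos.2 (mul_nonneg (by positivity) (hF0 t ht))) ht
  have d0 := hD0 0 le_rfl
  obtain ⟨C, hC, hDF⟩ := NormalizedFactor.exists_one_sub_meanCurv_le (D 0)
  have hDF : ∀ t, 0 ≤ t → D t ≤ C * F t := fun t ht => by
    rw [hDm t ht]
    exact hDF _ _ _ (h.factor t ht) (hDle t ht)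
  have hy0 : ∀ t, 0 ≤ ∫ x in (0:ℝ)..(2 * π), u x t ^ 2 := fun t =>
    intervalIntegral.integral_nonneg two_pi_pos.le fun _ _ => sq_nonneg _
  obtain ⟨K, hK⟩ := exists_forall_le_of_deriv_le_sqrt_add (by positivity) hC
    (show 0 ≤ 2 * (4 + 3 * D 0) by positivity) hD' hF0 hD0 hDF
    (fun t ht => h.hasDerivAt_integral_weight_sq ht)
    (fun t ht => two_pi_pos.trans_le (h.factor t ht).two_pi_le_integral_weight_sq)
    (fun t ht => (h.factor t ht).neg_integral_curv_sub_mul_weight_sq_le (hDle t ht))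
  have hK1 : 1 ≤ K := by
    linarith [hK 0 le_rfl, (h.factor 0 le_rfl).two_pi_le_integral_weight_sq, two_le_pi]
  obtain ⟨Y, hY⟩ := exists_forall_le_of_deriv_le_sqrt_add (by positivity) hC
    (show 0 ≤ 1 / 2 * √K * √(2 + π + 2 * π ^ 2 * D 0) * (4 + 3 * D 0) by positivity)
    hD' hF0 hD0 hDF (fun t ht => (h.hasDerivAt_integral_sq ht).add_const 1)
    (fun t _ => add_pos_of_nonneg_of_pos (hy0 t) one_pos)
    (fun t ht => (h.factor t ht).half_integral_curv_sub_mul_sq_le (hDle t ht)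
      (Real.one_le_sqrt.2 hK1) (Real.sqrt_le_sqrt (hK t ht)))
  refine ⟨max (1 + √(Y + 2 * π * D 0) * √K) (√((2 + π + 2 * π ^ 2 * D 0) * Y)), fun x t ht =>
    ⟨le_max_of_le_left (((h.factor t ht).inv_le (hDle t ht) x).trans ?_),
    le_max_of_le_right (Real.le_sqrt_of_sq_le
      (((h.factor t ht).sq_le_mul_integral_sq (hDle t ht) x).trans ?_))⟩⟩
  · gcongr
    · linarith [hY t ht]
    · exact hK t ht
  · gcongr
    exact hY t ht

end NormalizedFlow

theorem integral_weight_eq_of_flow {u uₜ R : ℝ → ℝ → ℝ}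
    (c0 : Continuous fun p : ℝ × ℝ => u p.1 p.2) (ct : Continuous fun p : ℝ × ℝ => uₜ p.1 p.2)
    (cR : ∀ t, Continuous fun x => R x t) (hpos : ∀ x t, 0 < u x t)
    (hd : ∀ x t, HasDerivAt (fun t => u x t) (uₜ x t) t)
    (hflow : ∀ x t, 0 ≤ t → uₜ x t = 1 / 4 * (R x t -
      (∫ x in (0:ℝ)..(2 * π), R x t * ((u x t) ^ 2)⁻¹) /
        ∫ x in (0:ℝ)..(2 * π), ((u x t) ^ 2)⁻¹) * u x t) {t : ℝ} (ht : 0 ≤ t) :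
    ∫ x in (0:ℝ)..(2 * π), ((u x t) ^ 2)⁻¹ = ∫ x in (0:ℝ)..(2 * π), ((u x 0) ^ 2)⁻¹ := by
  have hne : ∀ p : ℝ × ℝ, u p.1 p.2 ≠ 0 := fun p => (hpos p.1 p.2).ne'
  have hne2 : ∀ p : ℝ × ℝ, u p.1 p.2 ^ 2 ≠ 0 := fun p => pow_ne_zero 2 (hne p)
  have cw : ∀ t, Continuous fun x => ((u x t) ^ 2)⁻¹ := fun t =>
    ((c0.comp (by fun_prop : Continuous fun x : ℝ => (x, t))).pow 2).inv₀ fun x => hne2 (x, t)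
  have hV : ∀ t, 0 ≤ t → HasDerivAt (fun t => ∫ x in (0:ℝ)..(2 * π), ((u x t) ^ 2)⁻¹) 0 t := by
    intro t ht
    have hd := hasDerivAt_integral_of_continuous (a := 0) (b := 2 * π)
      (F := fun x t => (u x t ^ 2)⁻¹) (F' := fun x t => -2 * uₜ x t * (u x t)⁻¹ * (u x t ^ 2)⁻¹)
      (by fun_prop (disch := assumption)) (by fun_prop (disch := assumption))
      (fun x t => (((hd x t).pow 2).inv (hne2 (x, t))).congr_deriv (by
        have := (hpos x t).ne'
        simp only [Pi.pow_apply]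
        field_simp
        push_cast
        ring)) t
    refine hd.congr_deriv ?_
    have cwt := cw t
    have cRt := cR t
    have hVpos : 0 < ∫ x in (0:ℝ)..(2 * π), ((u x t) ^ 2)⁻¹ :=
      intervalIntegral.intervalIntegral_pos_of_pos (cwt.intervalIntegrable _ _)
        (fun x => inv_pos.2 (pow_pos (hpos x t) 2)) two_pi_pos
    have hfl := fun x => hflow x t ht
    set V := ∫ x in (0:ℝ)..(2 * π), ((u x t) ^ 2)⁻¹ with hVdef
    set S := ∫ x in (0:ℝ)..(2 * π), R x t * ((u x t) ^ 2)⁻¹ with hS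
    obtain ⟨a, ha⟩ : ∃ a, a = S / V := ⟨_, rfl⟩
    rw [← ha] at hfl
    have e : ∫ x in (0:ℝ)..(2 * π), -2 * uₜ x t * (u x t)⁻¹ * (u x t ^ 2)⁻¹ =
        -(1 / 2) * S + 1 / 2 * a * V := by
      rw [hS, hVdef, ← intervalIntegral.integral_const_mul,
        ← intervalIntegral.integral_const_mul, ← intervalIntegral.integral_add]
      · refine intervalIntegral.integral_congr fun x _ => ?_
        have := (hpos x t).ne'
        simp only [hfl]
        field_simp
        ring
      all_goals exact Continuous.intervalIntegrable (by fun_prop) _ _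
    rw [e, ha, mul_assoc, div_mul_cancel₀ _ hVpos.ne']
    ring
  exact le_antisymm (le_of_hasDerivAt_nonpos hV (fun _ _ => le_rfl) ht)
    (neg_le_neg_iff.1 (le_of_hasDerivAt_nonpos (fun t ht => (hV t ht).neg)
      (fun _ _ => neg_zero.le) ht))

/-- Uniform-in-time two-sided bound on the conformal factor under the
normalized Yamabe flow on S¹: there is `C ≥ 1` with `1/C ≤ u ≤ C`
for all θ and all t ≥ 0. -/
theorem yamabe_flow_uniform_bound
    (u : ℝ → ℝ → ℝ)
    (hu : ContDiff ℝ (⊤ : ℕ∞) (fun p : ℝ × ℝ => u p.1 p.2))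
    (huper : ∀ θ t, u (θ + 2 * π) t = u θ t)
    (hupos : ∀ θ t, 0 < u θ t)
    (R : ℝ → ℝ → ℝ)
    (hR : ∀ θ t, R θ t = (u θ t) ^ 3 * (4 * deriv (deriv (fun x => u x t)) θ + u θ t))
    (Rbar : ℝ → ℝ)
    (hRbar : ∀ t, Rbar t =
      (∫ θ in (0:ℝ)..(2 * π), R θ t * ((u θ t) ^ 2)⁻¹) /
        ∫ θ in (0:ℝ)..(2 * π), ((u θ t) ^ 2)⁻¹)
    (hflow : ∀ θ t, 0 ≤ t →
      deriv (fun s => u θ s) t = (1 / 4) * (R θ t - Rbar t) * u θ t)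
    (hnorm : ∫ θ in (0:ℝ)..(2 * π), ((u θ 0) ^ 2)⁻¹ = 2 * π) :
    ∃ C : ℝ, 1 ≤ C ∧
      ∀ θ t : ℝ, 0 ≤ t → C⁻¹ ≤ u θ t ∧ u θ t ≤ C := by
  set U : ℝ × ℝ → ℝ := fun p => u p.1 p.2 with hU
  have smooth : ∀ {G : ℝ × ℝ → ℝ} (v : ℝ × ℝ), ContDiff ℝ (⊤ : ℕ∞) G →
      ContDiff ℝ (⊤ : ℕ∞) fun p => fderiv ℝ G p v := fun v hG =>
    (hG.fderiv_right (by norm_cast)).clm_apply contDiff_const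
  have diff : ∀ {G : ℝ × ℝ → ℝ}, ContDiff ℝ (⊤ : ℕ∞) G → Differentiable ℝ G := fun hG =>
    hG.differentiable (by simp)
  set U₁ : ℝ × ℝ → ℝ := fun p => fderiv ℝ U p (1, 0) with hU₁
  set Uₜ : ℝ × ℝ → ℝ := fun p => fderiv ℝ U p (0, 1) with hUₜ
  have s1 : ContDiff ℝ (⊤ : ℕ∞) U₁ := smooth _ hu
  have st : ContDiff ℝ (⊤ : ℕ∞) Uₜ := smooth _ hu
  have s2 : ContDiff ℝ (⊤ : ℕ∞) fun p => fderiv ℝ U₁ p (1, 0) := smooth _ s1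
  have s1t : ContDiff ℝ (⊤ : ℕ∞) fun p => fderiv ℝ U₁ p (0, 1) := smooth _ s1
  have slice : ∀ {G : ℝ × ℝ → ℝ} (t : ℝ), ContDiff ℝ (⊤ : ℕ∞) G → Continuous fun x => G (x, t) :=
    fun t hG => hG.continuous.comp (by fun_prop)
  have d1 : ∀ x t, HasDerivAt (fun x => u x t) (U₁ (x, t)) x :=
    hasDerivAt_fst_of_differentiable (diff hu)
  have d2 : ∀ x t, HasDerivAt (fun x => U₁ (x, t)) (fderiv ℝ U₁ (x, t) (1, 0)) x :=
    hasDerivAt_fst_of_differentiable (diff s1)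
  have dt : ∀ x t, HasDerivAt (fun t => u x t) (Uₜ (x, t)) t :=
    hasDerivAt_snd_of_differentiable (diff hu)
  have hR' : ∀ x t, R x t = curv (fun x => u x t) (fun x => fderiv ℝ U₁ (x, t) (1, 0)) x := by
    intro x t
    rw [hR, funext fun x => (d1 x t).deriv, (d2 x t).deriv, curv]
  have cR : ∀ t, Continuous fun x => R x t := fun t => by
    have h0 : Continuous fun x => u x t := slice t hu
    have h2 := slice t s2
    simp only [hR', curv]
    fun_prop
  have hlen : ∀ t, 0 ≤ t → ∫ x in (0:ℝ)..(2 * π), ((u x t) ^ 2)⁻¹ = 2 * π := fun t ht =>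
    (integral_weight_eq_of_flow (uₜ := fun x t => Uₜ (x, t)) hu.continuous st.continuous cR hupos
      dt (fun x t ht => by rw [← hRbar, ← hflow x t ht, (dt x t).deriv]) ht).trans hnorm
  have hN : NormalizedFlow u (fun x t => U₁ (x, t)) (fun x t => fderiv ℝ U₁ (x, t) (1, 0))
      (fun x t => Uₜ (x, t)) (fun x t => fderiv ℝ U₁ (x, t) (0, 1)) :=
    { continuous0 := hu.continuous
      continuous1 := s1.continuous
      continuous_t := st.continuous
      continuous_1t := s1t.continuous
      deriv_t := dt
      deriv_1t := hasDerivAt_snd_of_differentiable (diff s1)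
      deriv_t1 := fun x t => (hasDerivAt_fst_of_differentiable (diff st) x t).congr_deriv
        (fderiv_fderiv_apply_comm hu _ _ _)
      pos := hupos
      factor := fun t ht => ⟨fun x => d1 x t, fun x => d2 x t, slice t s2, fun x => huper x t,
        fun x => hupos x t, hlen t ht⟩
      flow := fun x t ht => by
        rw [← (dt x t).deriv, hflow x t ht, hRbar, hlen t ht, ← hR', meanCurv]
        simp only [hR'] }
  obtain ⟨B, hB⟩ := hN.exists_bound
  refine ⟨max 1 B, le_max_left _ _, fun θ t ht => ⟨?_, le_max_of_le_right (hB θ t ht).2⟩⟩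
  exact inv_le_of_inv_le₀ (hupos θ t) (le_max_of_le_right (hB θ t ht).1)
end

section
/- Let u : ℝ × [0,∞) → ℝ be a smooth function, 2π-periodic in its first variable, with u(θ,t) > 0 everywhere, satisfying the normalized Yamabe flow ∂_t u = (1/4)(R − R̄)·u with R(θ,t) = u³·(4·∂²_θ u + u), R̄(t) = (∫_0^{2π} R u^{−2} dθ)/(∫_0^{2π} u^{−2} dθ), and ∫_0^{2π} u(θ,0)^{−2} dθ = 2π. For p ≥ 2 define F_p(t) = ∫_0^{2π} |R(θ,t) − R̄(t)|^p · u(θ,t)^{−2} dθ. Then for every p ≥ 2: F_p(t) → 0 as t → +∞, and ∫_0^∞ F_p(t) dt < ∞. -/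
open Real MeasureTheory Filter Topology

/-- Partial derivative in the first variable. -/
noncomputable def spaceDeriv (f : ℝ → ℝ → ℝ) (θ t : ℝ) : ℝ := deriv (fun x => f x t) θ

/-- Partial derivative in the second variable. -/
noncomputable def timeDeriv (f : ℝ → ℝ → ℝ) (θ t : ℝ) : ℝ := deriv (fun s => f θ s) t

/-- Joint smoothness of a function of two real variables. -/
def Smooth₂ (f : ℝ → ℝ → ℝ) : Prop := ContDiff ℝ (⊤ : ℕ∞) (fun p : ℝ × ℝ => f p.1 p.2)

namespace Smooth₂

variable {f : ℝ → ℝ → ℝ}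

lemma hasFDerivAt (hf : Smooth₂ f) (p : ℝ × ℝ) :
    HasFDerivAt (fun p : ℝ × ℝ => f p.1 p.2) (fderiv ℝ (fun p : ℝ × ℝ => f p.1 p.2) p) p :=
  (hf.differentiable (by simp) p).hasFDerivAt

lemma hasDerivAt_fst (hf : Smooth₂ f) (θ t : ℝ) :
    HasDerivAt (fun x => f x t) (fderiv ℝ (fun p : ℝ × ℝ => f p.1 p.2) (θ, t) (1, 0)) θ :=
  (hf.hasFDerivAt (θ, t)).comp_hasDerivAt (f := fun x => (x, t)) θ
    ((hasDerivAt_id θ).prodMk (hasDerivAt_const θ t))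

lemma hasDerivAt_snd (hf : Smooth₂ f) (θ t : ℝ) :
    HasDerivAt (fun s => f θ s) (fderiv ℝ (fun p : ℝ × ℝ => f p.1 p.2) (θ, t) (0, 1)) t :=
  (hf.hasFDerivAt (θ, t)).comp_hasDerivAt (f := fun s => (θ, s)) t
    ((hasDerivAt_const t θ).prodMk (hasDerivAt_id t))

lemma hasDerivAt_spaceDeriv (hf : Smooth₂ f) (θ t : ℝ) :
    HasDerivAt (fun x => f x t) (spaceDeriv f θ t) θ :=
  (hf.hasDerivAt_fst θ t).differentiableAt.hasDerivAt

lemma hasDerivAt_timeDeriv (hf : Smooth₂ f) (θ t : ℝ) :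
    HasDerivAt (fun s => f θ s) (timeDeriv f θ t) t :=
  (hf.hasDerivAt_snd θ t).differentiableAt.hasDerivAt

lemma spaceDeriv_eq (hf : Smooth₂ f) (θ t : ℝ) :
    spaceDeriv f θ t = fderiv ℝ (fun p : ℝ × ℝ => f p.1 p.2) (θ, t) (1, 0) :=
  (hf.hasDerivAt_fst θ t).deriv

lemma timeDeriv_eq (hf : Smooth₂ f) (θ t : ℝ) :
    timeDeriv f θ t = fderiv ℝ (fun p : ℝ × ℝ => f p.1 p.2) (θ, t) (0, 1) :=
  (hf.hasDerivAt_snd θ t).deriv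

lemma fderiv_apply (hf : Smooth₂ f) (v : ℝ × ℝ) :
    Smooth₂ fun θ t => fderiv ℝ (fun p : ℝ × ℝ => f p.1 p.2) (θ, t) v :=
  (ContDiff.fderiv_right (m := (⊤ : ℕ∞)) hf (by simp)).clm_apply contDiff_const

lemma spaceDeriv (hf : Smooth₂ f) : Smooth₂ (spaceDeriv f) := by
  have h : _root_.spaceDeriv f = _ := funext₂ hf.spaceDeriv_eq
  rw [h]; exact hf.fderiv_apply (1, 0)

lemma timeDeriv (hf : Smooth₂ f) : Smooth₂ (timeDeriv f) := by
  have h : _root_.timeDeriv f = _ := funext₂ hf.timeDeriv_eq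
  rw [h]; exact hf.fderiv_apply (0, 1)

lemma timeDeriv_spaceDeriv (hf : Smooth₂ f) (θ t : ℝ) :
    _root_.timeDeriv (_root_.spaceDeriv f) θ t = _root_.spaceDeriv (_root_.timeDeriv f) θ t := by
  have h₁ : _root_.spaceDeriv f = _ := funext₂ hf.spaceDeriv_eq
  have h₂ : _root_.timeDeriv f = _ := funext₂ hf.timeDeriv_eq
  have hd : DifferentiableAt ℝ (fderiv ℝ (fun p : ℝ × ℝ => f p.1 p.2)) (θ, t) :=
    (ContDiff.fderiv_right (m := (⊤ : ℕ∞)) hf (by simp)).differentiable (by simp) _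
  rw [h₁, h₂, (hf.fderiv_apply (1, 0)).timeDeriv_eq, (hf.fderiv_apply (0, 1)).spaceDeriv_eq]
  have key (v w : ℝ × ℝ) : fderiv ℝ
      (fun p : ℝ × ℝ => fderiv ℝ (fun p : ℝ × ℝ => f p.1 p.2) (p.1, p.2) v) (θ, t) w =
      fderiv ℝ (fderiv ℝ (fun p : ℝ × ℝ => f p.1 p.2)) (θ, t) w v := by
    have := (hd.hasFDerivAt.clm_apply (hasFDerivAt_const v (θ, t))).fderiv
    simp only [Prod.mk.eta]
    rw [this]
    simp
  rw [key, key]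
  exact (ContDiff.contDiffAt hf).isSymmSndFDerivAt (by simpa using WithTop.coe_le_coe.2 (le_top (a := (2 : ℕ∞)))) _ _

lemma continuous (hf : Smooth₂ f) : Continuous fun p : ℝ × ℝ => f p.1 p.2 :=
  ContDiff.continuous hf

lemma continuous_fst (hf : Smooth₂ f) (t : ℝ) : Continuous fun θ => f θ t :=
  hf.continuous.comp (by fun_prop : Continuous fun θ : ℝ => (θ, t))

lemma hasDerivAt_integral (hf : Smooth₂ f) (a b t : ℝ) :
    HasDerivAt (fun s => ∫ θ in a..b, f θ s) (∫ θ in a..b, _root_.timeDeriv f θ t) t := by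
  have hK : IsCompact (Set.uIcc a b ×ˢ Metric.closedBall t 1) :=
    isCompact_uIcc.prod (isCompact_closedBall t 1)
  obtain ⟨C, hC⟩ := hK.exists_bound_of_continuousOn hf.timeDeriv.continuous.continuousOn
  refine (intervalIntegral.hasDerivAt_integral_of_dominated_loc_of_deriv_le
    (F := fun s θ => f θ s) (F' := fun s θ => _root_.timeDeriv f θ s) (bound := fun _ => C)
    (Metric.closedBall_mem_nhds t one_pos) (Eventually.of_forall fun s => ?_) ?_ ?_
    (Eventually.of_forall fun θ hθ s hs => ?_) (by simp)
    (Eventually.of_forall fun θ _ s _ => hf.hasDerivAt_timeDeriv θ s)).2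
  · exact (hf.continuous_fst s).aestronglyMeasurable
  · exact (hf.continuous_fst t).intervalIntegrable _ _
  · exact (hf.timeDeriv.continuous_fst t).aestronglyMeasurable
  · exact hC (θ, s) ⟨Set.uIoc_subset_uIcc hθ, hs⟩

end Smooth₂

lemma integrableOn_Ici_of_le_deriv {f H H' : ℝ → ℝ} {B : ℝ} (hf : Continuous f)
    (hf0 : ∀ t, 0 ≤ t → 0 ≤ f t) (hH : ∀ t, 0 ≤ t → HasDerivAt H (H' t) t)
    (hle : ∀ t, 0 ≤ t → f t ≤ H' t) (hB : ∀ t, 0 ≤ t → H t ≤ B) :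
    IntegrableOn f (Set.Ici 0) := by
  rw [integrableOn_Ici_iff_integrableOn_Ioi]
  refine integrableOn_Ioi_of_intervalIntegral_norm_bounded (B - H 0) 0
    (fun i => (hf.integrableOn_Icc (a := 0) (b := i)).mono_set Set.Ioc_subset_Icc_self)
    tendsto_id ?_
  filter_upwards [eventually_ge_atTop 0] with T hT
  have hmono : MonotoneOn (fun t => H t - ∫ s in (0 : ℝ)..t, f s) (Set.Ici 0) := by
    have hd (t : ℝ) (ht : 0 ≤ t) : HasDerivAt (fun t => H t - ∫ s in (0 : ℝ)..t, f s)
        (H' t - f t) t := (hH t ht).sub (hf.integral_hasStrictDerivAt 0 t).hasDerivAt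
    refine monotoneOn_of_deriv_nonneg (convex_Ici 0)
      (fun t ht => (hd t ht).continuousAt.continuousWithinAt)
      (fun t ht => (hd t (interior_subset ht)).differentiableAt.differentiableWithinAt) ?_
    intro t ht
    rw [(hd t (interior_subset ht)).deriv]
    linarith [hle t (interior_subset ht)]
  have h := hmono (Set.mem_Ici.2 le_rfl) (Set.mem_Ici.2 hT) hT
  have habs : ∫ s in (0 : ℝ)..T, ‖f s‖ = ∫ s in (0 : ℝ)..T, f s := by
    refine intervalIntegral.integral_congr fun s hs => ?_
    rw [Set.uIcc_of_le hT] at hs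
    exact abs_of_nonneg (hf0 s hs.1)
  simp only [habs]
  simp only [intervalIntegral.integral_same] at h
  linarith [hB T hT]

/-- A nonnegative integrable function with `f' ≤ C (f + f²) - d`, `d ≥ 0`, is bounded and tends to
zero, and `d` is integrable. -/
lemma decay_of_deriv_le {f f' d : ℝ → ℝ} {C : ℝ} (hC : 0 ≤ C) (hf : Continuous f)
    (hd : Continuous d) (hf0 : ∀ t, 0 ≤ t → 0 ≤ f t) (hd0 : ∀ t, 0 ≤ t → 0 ≤ d t)
    (hf' : ∀ t, 0 ≤ t → HasDerivAt f (f' t) t)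
    (hle : ∀ t, 0 ≤ t → f' t ≤ C * (f t + f t ^ 2) - d t)
    (hint : IntegrableOn f (Set.Ici 0)) :
    Tendsto f atTop (𝓝 0) ∧ (∃ B, ∀ t, 0 ≤ t → f t ≤ B) ∧ IntegrableOn d (Set.Ici 0) := by
  set I : ℝ → ℝ := fun t => ∫ s in (0 : ℝ)..t, f s with hI
  have hI' (t : ℝ) : HasDerivAt I (f t) t := (hf.integral_hasStrictDerivAt 0 t).hasDerivAt
  have hIlim : Tendsto I atTop (𝓝 (∫ s in Set.Ioi 0, f s)) :=
    intervalIntegral_tendsto_integral_Ioi 0 (hint.mono_set Set.Ioi_subset_Ici_self) tendsto_id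
  have hI0 (t : ℝ) (ht : 0 ≤ t) : 0 ≤ I t :=
    intervalIntegral.integral_nonneg ht fun s hs => hf0 s hs.1
  have hImono : MonotoneOn I (Set.Ici 0) := by
    refine monotoneOn_of_deriv_nonneg (convex_Ici 0)
      (fun t _ => (hI' t).continuousAt.continuousWithinAt)
      (fun t _ => (hI' t).differentiableAt.differentiableWithinAt) fun t ht => ?_
    rw [(hI' t).deriv]
    exact hf0 t (interior_subset ht)
  have hIle (t : ℝ) (ht : 0 ≤ t) : I t ≤ ∫ s in Set.Ioi 0, f s :=
    ge_of_tendsto hIlim (by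
      filter_upwards [eventually_ge_atTop t] with s hs
      exact hImono ht (ht.trans hs) hs)
  set g : ℝ → ℝ := fun t => log (1 + f t) - C * I t with hg
  have hg' (t : ℝ) (ht : 0 ≤ t) : HasDerivAt g (f' t / (1 + f t) - C * f t) t :=
    (((hf' t ht).const_add 1).log (by linarith [hf0 t ht])).sub ((hI' t).const_mul C)
  have hganti : AntitoneOn g (Set.Ici 0) := by
    refine antitoneOn_of_deriv_nonpos (convex_Ici 0)
      (fun t ht => (hg' t ht).continuousAt.continuousWithinAt)
      (fun t ht => (hg' t (interior_subset ht)).differentiableAt.differentiableWithinAt) ?_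
    intro t ht
    have ht := interior_subset ht
    have h0 := hf0 t ht
    rw [(hg' t ht).deriv, sub_nonpos, div_le_iff₀ (by linarith)]
    nlinarith [hle t ht, hd0 t ht]
  have hglb (t : ℝ) (ht : 0 ≤ t) : -(C * ∫ s in Set.Ioi 0, f s) ≤ g t := by
    have h1 := log_nonneg (by linarith [hf0 t ht] : (1 : ℝ) ≤ 1 + f t)
    have h2 := mul_le_mul_of_nonneg_left (hIle t ht) hC
    simp only [hg]; linarith
  obtain ⟨l, hl⟩ : ∃ l, Tendsto g atTop (𝓝 l) := by
    have hanti : Antitone fun t => g (max t 0) := fun s t hst =>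
      hganti (Set.mem_Ici.2 (le_max_right _ _)) (Set.mem_Ici.2 (le_max_right _ _)) (max_le_max_right 0 hst)
    refine ⟨_, (tendsto_atTop_ciInf hanti
      ⟨_, Set.forall_mem_range.2 fun t => hglb _ (le_max_right t 0)⟩).congr' ?_⟩
    filter_upwards [eventually_ge_atTop 0] with t ht
    rw [max_eq_left ht]
  have hflim : Tendsto f atTop (𝓝 (exp (l + C * ∫ s in Set.Ioi 0, f s) - 1)) := by
    refine (((continuous_exp.tendsto _).comp (hl.add (hIlim.const_mul C))).sub_const 1).congr' ?_
    filter_upwards [eventually_ge_atTop 0] with t ht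
    simp only [Function.comp, hg, sub_add_cancel]
    rw [exp_log (by linarith [hf0 t ht])]
    ring
  have hzero : exp (l + C * ∫ s in Set.Ioi 0, f s) - 1 = 0 := by
    refine IntegrableAtFilter.eq_zero_of_tendsto (μ := volume) (l := atTop) (f := f)
      ⟨Set.Ici 0, Ici_mem_atTop 0, hint⟩ (fun s hs => ?_) hflim
    obtain ⟨b, hb⟩ := mem_atTop_sets.1 hs
    exact top_unique (Real.volume_Ici (a := b) ▸ measure_mono hb)
  have hbound : ∃ B, ∀ t, 0 ≤ t → f t ≤ B := by
    refine ⟨exp (g 0 + C * ∫ s in Set.Ioi 0, f s) - 1, fun t ht => ?_⟩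
    have h1 := hganti (Set.mem_Ici.2 le_rfl) ht ht
    have h2 := mul_le_mul_of_nonneg_left (hIle t ht) hC
    have h3 : log (1 + f t) ≤ g 0 + C * ∫ s in Set.Ioi 0, f s := by
      have : log (1 + f t) = g t + C * I t := by simp [hg]
      linarith
    have := (log_le_iff_le_exp (by linarith [hf0 t ht])).1 h3
    linarith
  refine ⟨hzero ▸ hflim, hbound, ?_⟩
  obtain ⟨B, hB⟩ := hbound
  have hB0 : 0 ≤ B := (hf0 0 le_rfl).trans (hB 0 le_rfl)
  refine integrableOn_Ici_of_le_deriv (H := fun t => C * (1 + B) * I t - f t)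
    (B := C * (1 + B) * ∫ s in Set.Ioi 0, f s) hd hd0
    (fun t ht => ((hI' t).const_mul (C * (1 + B))).sub (hf' t ht)) (fun t ht => ?_) fun t ht => ?_
  · have h1 : f t ^ 2 ≤ B * f t := by nlinarith [hf0 t ht, hB t ht]
    nlinarith [hle t ht, mul_le_mul_of_nonneg_left h1 hC]
  · have := mul_le_mul_of_nonneg_left (hIle t ht) (by positivity : 0 ≤ C * (1 + B))
    linarith [hf0 t ht]

/-- Wirtinger's inequality with Dirichlet boundary conditions on an interval of length `2π`. -/
lemma wirtinger_dirichlet {f f' : ℝ → ℝ} {a : ℝ} (hf : ∀ x, HasDerivAt f (f' x) x)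
    (hf' : Continuous f') (ha : f a = 0) (hb : f (a + 2 * π) = 0) :
    (1 / 2) ^ 2 * ∫ x in a..(a + 2 * π), f x ^ 2 ≤ ∫ x in a..(a + 2 * π), f' x ^ 2 := by
  have hfc : Continuous f := continuous_iff_continuousAt.2 fun x => (hf x).continuousAt
  have hab : a ≤ a + 2 * π := by linarith [pi_pos]
  have key (c : ℝ) (hc0 : 0 < c) (hc : c < 1 / 2) :
      c ^ 2 * ∫ x in a..(a + 2 * π), f x ^ 2 ≤ ∫ x in a..(a + 2 * π), f' x ^ 2 := by
    have hcos (x : ℝ) (hx : x ∈ Set.uIcc a (a + 2 * π)) : cos (c * (x - a - π)) ≠ 0 := by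
      rw [Set.uIcc_of_le hab] at hx
      have h1 : |c * (x - a - π)| < π / 2 := by
        rw [abs_mul, abs_of_pos hc0]
        have : |x - a - π| ≤ π := abs_le.2 ⟨by linarith [hx.1], by linarith [hx.2]⟩
        nlinarith [pi_pos]
      exact (cos_pos_of_mem_Ioo (abs_lt.1 h1)).ne'
    have hlin (x : ℝ) : HasDerivAt (fun x => c * (x - a - π)) c x := by
      simpa using (((hasDerivAt_id x).sub_const a).sub_const π).const_mul c
    have hG (x : ℝ) (hx : x ∈ Set.uIcc a (a + 2 * π)) :
        HasDerivAt (fun x => c * tan (c * (x - a - π)) * f x ^ 2)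
          ((f' x + c * tan (c * (x - a - π)) * f x) ^ 2 - (f' x ^ 2 - c ^ 2 * f x ^ 2)) x := by
      have h := (((hasDerivAt_tan (hcos x hx)).comp x (hlin x)).const_mul c).mul ((hf x).pow 2)
      refine h.congr_deriv ?_
      have h1 := one_add_tan_sq_mul_cos_sq_eq_one (hcos x hx)
      have h2 : 1 / cos (c * (x - a - π)) ^ 2 = 1 + tan (c * (x - a - π)) ^ 2 := by
        rw [div_eq_iff (pow_ne_zero 2 (hcos x hx)), h1]
      simp only [Function.comp, h2, Pi.pow_apply]
      push_cast
      ring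
    have htan : ContinuousOn (fun x => tan (c * (x - a - π))) (Set.uIcc a (a + 2 * π)) :=
      fun x hx => ((hasDerivAt_tan (hcos x hx)).continuousAt.comp
        (f := fun x => c * (x - a - π)) (hlin x).continuousAt).continuousWithinAt
    have hi1 : IntervalIntegrable (fun x => (f' x + c * tan (c * (x - a - π)) * f x) ^ 2) volume
        a (a + 2 * π) := by
      apply ContinuousOn.intervalIntegrable
      fun_prop
    have hi2 : IntervalIntegrable (fun x => f' x ^ 2) volume a (a + 2 * π) :=
      (hf'.pow 2).intervalIntegrable _ _
    have hi3 : IntervalIntegrable (fun x => c ^ 2 * f x ^ 2) volume a (a + 2 * π) :=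
      (continuous_const.mul (hfc.pow 2)).intervalIntegrable _ _
    have h := intervalIntegral.integral_eq_sub_of_hasDerivAt hG (hi1.sub (hi2.sub hi3))
    rw [intervalIntegral.integral_sub hi1 (hi2.sub hi3), intervalIntegral.integral_sub hi2 hi3,
      ha, hb, intervalIntegral.integral_const_mul] at h
    have hpos : 0 ≤ ∫ x in a..(a + 2 * π), (f' x + c * tan (c * (x - a - π)) * f x) ^ 2 :=
      intervalIntegral.integral_nonneg hab fun x _ => sq_nonneg _
    norm_num at h
    linarith
  have hlim : Tendsto (fun c : ℝ => c ^ 2 * ∫ x in a..(a + 2 * π), f x ^ 2) (𝓝[<] (1 / 2))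
      (𝓝 ((1 / 2) ^ 2 * ∫ x in a..(a + 2 * π), f x ^ 2)) :=
    (Continuous.tendsto (by fun_prop) _).mono_left nhdsWithin_le_nhds
  refine le_of_tendsto hlim ?_
  filter_upwards [Ioo_mem_nhdsLT (by norm_num : (0 : ℝ) < 1 / 2)] with c hc
  exact key c hc.1 hc.2

lemma integral_sq_sub_deriv_sq_le {u u' : ℝ → ℝ} (hu : ∀ x, HasDerivAt u (u' x) x)
    (hu' : Continuous u') (hpos : ∀ x, 0 < u x) (hper : Function.Periodic u (2 * π))
    (hper' : Function.Periodic u' (2 * π)) (hL : ∫ x in (0 : ℝ)..(2 * π), (u x ^ 2)⁻¹ = 2 * π) :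
    ∫ x in (0 : ℝ)..(2 * π), (u x ^ 2 - 4 * u' x ^ 2) ≤ 2 * π := by
  have huc : Continuous u := continuous_iff_continuousAt.2 fun x => (hu x).continuousAt
  have hne (x : ℝ) : u x ≠ 0 := (hpos x).ne'
  have hvc : Continuous fun x => (u x ^ 2)⁻¹ := (huc.pow 2).inv₀ fun x => pow_ne_zero 2 (hne x)
  set S : ℝ → ℝ := fun x => ∫ y in (0 : ℝ)..x, (u y ^ 2)⁻¹ with hS
  have hS' (x : ℝ) : HasDerivAt S (u x ^ 2)⁻¹ x :=
    (hvc.integral_hasStrictDerivAt 0 x).hasDerivAt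
  have hSc : Continuous S := continuous_iff_continuousAt.2 fun x => (hS' x).continuousAt
  have hS0 : S 0 = 0 := intervalIntegral.integral_same
  have hSper (x : ℝ) : S (x + 2 * π) = S x + 2 * π := by
    have hvper : Function.Periodic (fun x => (u x ^ 2)⁻¹) (2 * π) := fun x => by simp only [hper x]
    have h := hvper.intervalIntegral_add_eq x 0
    rw [zero_add, hL] at h
    simp only [hS]
    rw [← intervalIntegral.integral_add_adjacent_intervals (hvc.intervalIntegrable 0 x)
      (hvc.intervalIntegrable x _), h]
  -- the two functions `u cos (S / 2)` and `u sin (S / 2)` are antiperiodic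
  have hc' (x : ℝ) : HasDerivAt (fun x => u x * cos (S x / 2))
      (u' x * cos (S x / 2) - (u x)⁻¹ / 2 * sin (S x / 2)) x := by
    refine ((hu x).mul (((hS' x).div_const 2).cos)).congr_deriv ?_
    field_simp [hne x]
    ring
  have hs' (x : ℝ) : HasDerivAt (fun x => u x * sin (S x / 2))
      (u' x * sin (S x / 2) + (u x)⁻¹ / 2 * cos (S x / 2)) x := by
    refine ((hu x).mul (((hS' x).div_const 2).sin)).congr_deriv ?_
    field_simp [hne x]
  have hinv : Continuous fun x => (u x)⁻¹ := huc.inv₀ hne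
  have hshift (x : ℝ) : S (x + 2 * π) / 2 = S x / 2 + π := by rw [hSper]; ring
  have hwirt {f f' : ℝ → ℝ} (hf : ∀ x, HasDerivAt f (f' x) x) (hf' : Continuous f')
      (hanti : ∀ x, f (x + 2 * π) = -f x) (hanti' : ∀ x, f' (x + 2 * π) = -f' x)
      (hz : ∃ a, f a = 0) :
      (1 / 2) ^ 2 * ∫ x in (0 : ℝ)..(2 * π), f x ^ 2 ≤ ∫ x in (0 : ℝ)..(2 * π), f' x ^ 2 := by
    obtain ⟨a, ha⟩ := hz
    have h := wirtinger_dirichlet hf hf' ha (by rw [hanti, ha, neg_zero])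
    have h1 : Function.Periodic (fun x => f x ^ 2) (2 * π) := fun x => by
      simp only [hanti, neg_sq]
    have h2 : Function.Periodic (fun x => f' x ^ 2) (2 * π) := fun x => by
      simp only [hanti', neg_sq]
    have h1 := h1.intervalIntegral_add_eq a 0
    have h2 := h2.intervalIntegral_add_eq a 0
    rw [zero_add] at h1 h2
    rwa [h1, h2] at h
  have hc := hwirt hc' (by fun_prop)
    (fun x => by simp only [hper x, hshift, cos_add_pi]; ring)
    (fun x => by simp only [hper x, hper' x, hshift, cos_add_pi, sin_add_pi]; ring) (by
      obtain ⟨b, -, hb⟩ := intermediate_value_Icc (by positivity : (0 : ℝ) ≤ 2 * π)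
        hSc.continuousOn (show π ∈ Set.Icc (S 0) (S (2 * π)) by
          rw [show S (2 * π) = 2 * π from hL, hS0]
          constructor <;> linarith [pi_pos])
      exact ⟨b, by rw [hb, cos_pi_div_two, mul_zero]⟩)
  have hs := hwirt hs' (by fun_prop)
    (fun x => by simp only [hper x, hshift, sin_add_pi]; ring)
    (fun x => by simp only [hper x, hper' x, hshift, cos_add_pi, sin_add_pi]; ring)
    ⟨0, by simp [hS0]⟩
  have hsum := add_le_add hc hs
  rw [← mul_add, ← intervalIntegral.integral_add, ← intervalIntegral.integral_add] at hsum
  · have e1 : ∫ x in (0 : ℝ)..(2 * π), ((u x * cos (S x / 2)) ^ 2 + (u x * sin (S x / 2)) ^ 2) =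
        ∫ x in (0 : ℝ)..(2 * π), u x ^ 2 :=
      intervalIntegral.integral_congr fun x _ => by
        linear_combination u x ^ 2 * cos_sq_add_sin_sq (S x / 2)
    have e2 : ∫ x in (0 : ℝ)..(2 * π), ((u' x * cos (S x / 2) - (u x)⁻¹ / 2 * sin (S x / 2)) ^ 2 +
        (u' x * sin (S x / 2) + (u x)⁻¹ / 2 * cos (S x / 2)) ^ 2) =
        (∫ x in (0 : ℝ)..(2 * π), u' x ^ 2) + (1 / 4) * (2 * π) := by
      have hq : 1 / 4 * (2 * π) = ∫ x in (0 : ℝ)..(2 * π), 1 / 4 * (u x ^ 2)⁻¹ := by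
        rw [intervalIntegral.integral_const_mul, hL]
      rw [hq, ← intervalIntegral.integral_add
        ((by fun_prop : Continuous fun x => u' x ^ 2).intervalIntegrable _ _)
        ((by fun_prop : Continuous fun x => 1 / 4 * (u x ^ 2)⁻¹).intervalIntegrable _ _)]
      refine intervalIntegral.integral_congr fun x _ => ?_
      simp only [← inv_pow]
      linear_combination (u' x ^ 2 + 1 / 4 * (u x)⁻¹ ^ 2) * cos_sq_add_sin_sq (S x / 2)
    rw [e1, e2] at hsum
    rw [intervalIntegral.integral_sub ((by fun_prop : Continuous _).intervalIntegrable _ _)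
      ((by fun_prop : Continuous _).intervalIntegrable _ _), intervalIntegral.integral_const_mul]
    linarith
  all_goals exact Continuous.intervalIntegrable (by fun_prop) _ _

namespace Smooth₂

variable {f g : ℝ → ℝ → ℝ}

lemma mul (hf : Smooth₂ f) (hg : Smooth₂ g) : Smooth₂ fun θ t => f θ t * g θ t :=
  ContDiff.mul hf hg

lemma add (hf : Smooth₂ f) (hg : Smooth₂ g) : Smooth₂ fun θ t => f θ t + g θ t :=
  ContDiff.add hf hg

lemma const_mul (hf : Smooth₂ f) (c : ℝ) : Smooth₂ fun θ t => c * f θ t :=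
  contDiff_const.mul hf

lemma pow (hf : Smooth₂ f) (n : ℕ) : Smooth₂ fun θ t => f θ t ^ n :=
  ContDiff.pow hf n

lemma inv (hf : Smooth₂ f) (h : ∀ θ t, f θ t ≠ 0) : Smooth₂ fun θ t => (f θ t)⁻¹ :=
  ContDiff.inv hf fun p => h p.1 p.2

lemma integral_spaceDeriv (hf : Smooth₂ f) (hper : ∀ θ t, f (θ + 2 * π) t = f θ t) (t : ℝ) :
    ∫ θ in (0 : ℝ)..(2 * π), _root_.spaceDeriv f θ t = 0 := by
  rw [intervalIntegral.integral_eq_sub_of_hasDerivAt (fun x _ => hf.hasDerivAt_spaceDeriv x t)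
    ((hf.spaceDeriv.continuous_fst t).intervalIntegrable _ _), ← zero_add (2 * π), hper, sub_self]

end Smooth₂

lemma spaceDeriv_periodic {f : ℝ → ℝ → ℝ} (hper : ∀ θ t, f (θ + 2 * π) t = f θ t) (θ t : ℝ) :
    spaceDeriv f (θ + 2 * π) t = spaceDeriv f θ t := by
  simp only [spaceDeriv]
  rw [← deriv_comp_add_const]
  simp only [hper]

/-- A positive `2π`-periodic smooth solution `u` of the normalized Yamabe flow of length `2π`,
with curvature `R` and mean curvature `Rbar`. -/
structure IsNormalizedYamabeFlow (u R : ℝ → ℝ → ℝ) (Rbar : ℝ → ℝ) : Prop where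
  smooth : Smooth₂ u
  periodic : ∀ θ t, u (θ + 2 * π) t = u θ t
  pos : ∀ θ t, 0 < u θ t
  curvature_eq : ∀ θ t, R θ t = u θ t ^ 3 * (4 * spaceDeriv (spaceDeriv u) θ t + u θ t)
  mean_eq : ∀ t, Rbar t = (∫ θ in (0 : ℝ)..(2 * π), R θ t * (u θ t ^ 2)⁻¹) /
    ∫ θ in (0 : ℝ)..(2 * π), (u θ t ^ 2)⁻¹
  flow : ∀ θ t, 0 ≤ t → timeDeriv u θ t = 1 / 4 * (R θ t - Rbar t) * u θ t
  length : ∫ θ in (0 : ℝ)..(2 * π), (u θ 0 ^ 2)⁻¹ = 2 * π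

namespace IsNormalizedYamabeFlow

variable {u R : ℝ → ℝ → ℝ} {Rbar : ℝ → ℝ}

lemma ne_zero (h : IsNormalizedYamabeFlow u R Rbar) (θ t : ℝ) : u θ t ≠ 0 := (h.pos θ t).ne'

lemma smooth_density (h : IsNormalizedYamabeFlow u R Rbar) : Smooth₂ fun θ t => (u θ t ^ 2)⁻¹ :=
  (h.smooth.pow 2).inv fun θ t => pow_ne_zero 2 (h.ne_zero θ t)

lemma smooth_curvature (h : IsNormalizedYamabeFlow u R Rbar) : Smooth₂ R := by
  rw [show R = _ from funext₂ h.curvature_eq]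
  exact (h.smooth.pow 3).mul ((h.smooth.spaceDeriv.spaceDeriv.const_mul 4).add h.smooth)

lemma periodic_curvature (h : IsNormalizedYamabeFlow u R Rbar) (θ t : ℝ) :
    R (θ + 2 * π) t = R θ t := by
  simp only [h.curvature_eq, h.periodic, spaceDeriv_periodic (spaceDeriv_periodic h.periodic)]

lemma smooth_flux (h : IsNormalizedYamabeFlow u R Rbar) :
    Smooth₂ fun θ t => u θ t ^ 2 * spaceDeriv R θ t :=
  (h.smooth.pow 2).mul h.smooth_curvature.spaceDeriv

lemma periodic_flux (h : IsNormalizedYamabeFlow u R Rbar) (θ t : ℝ) :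
    u (θ + 2 * π) t ^ 2 * spaceDeriv R (θ + 2 * π) t = u θ t ^ 2 * spaceDeriv R θ t := by
  rw [h.periodic, spaceDeriv_periodic h.periodic_curvature]

lemma spaceDeriv_flux (h : IsNormalizedYamabeFlow u R Rbar) (θ t : ℝ) :
    spaceDeriv (fun θ t => u θ t ^ 2 * spaceDeriv R θ t) θ t =
      2 * u θ t * spaceDeriv u θ t * spaceDeriv R θ t +
        u θ t ^ 2 * spaceDeriv (spaceDeriv R) θ t := by
  have hd := ((h.smooth.hasDerivAt_spaceDeriv θ t).pow 2).mul
    (h.smooth_curvature.spaceDeriv.hasDerivAt_spaceDeriv θ t)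
  refine (HasDerivAt.deriv hd).trans ?_
  simp only [Pi.pow_apply]
  push_cast
  ring

lemma timeDeriv_density (h : IsNormalizedYamabeFlow u R Rbar) {t : ℝ} (ht : 0 ≤ t) (θ : ℝ) :
    timeDeriv (fun θ t => (u θ t ^ 2)⁻¹) θ t =
      -(1 / 2) * (R θ t - Rbar t) * (u θ t ^ 2)⁻¹ := by
  have hne := h.ne_zero θ t
  have hd := ((h.smooth.hasDerivAt_timeDeriv θ t).pow 2).inv (pow_ne_zero 2 hne)
  refine (HasDerivAt.deriv hd).trans ?_
  rw [h.flow θ t ht]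
  simp only [Pi.pow_apply]
  field_simp
  push_cast
  ring

lemma timeDeriv_curvature (h : IsNormalizedYamabeFlow u R Rbar) {t : ℝ} (ht : 0 ≤ t) (θ : ℝ) :
    timeDeriv R θ t = R θ t * (R θ t - Rbar t) +
      u θ t ^ 2 * spaceDeriv (fun θ t => u θ t ^ 2 * spaceDeriv R θ t) θ t := by
  have hR := h.smooth_curvature
  have hux : (fun θ => spaceDeriv (timeDeriv u) θ t) = fun θ =>
      1 / 4 * (spaceDeriv R θ t * u θ t + (R θ t - Rbar t) * spaceDeriv u θ t) := by
    funext x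
    have e : (fun y => timeDeriv u y t) = fun y => 1 / 4 * ((R y t - Rbar t) * u y t) :=
      funext fun y => by rw [h.flow y t ht, mul_assoc]
    rw [spaceDeriv, e]
    exact ((((hR.hasDerivAt_spaceDeriv x t).sub_const _).mul
      (h.smooth.hasDerivAt_spaceDeriv x t)).const_mul _).deriv
  have huxx : timeDeriv (spaceDeriv (spaceDeriv u)) θ t = 1 / 4 *
      (spaceDeriv (spaceDeriv R) θ t * u θ t + 2 * spaceDeriv R θ t * spaceDeriv u θ t +
        (R θ t - Rbar t) * spaceDeriv (spaceDeriv u) θ t) := by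
    rw [h.smooth.spaceDeriv.timeDeriv_spaceDeriv,
      show timeDeriv (spaceDeriv u) = _ from funext₂ h.smooth.timeDeriv_spaceDeriv,
      spaceDeriv, hux]
    refine ((((hR.spaceDeriv.hasDerivAt_spaceDeriv θ t).mul
      (h.smooth.hasDerivAt_spaceDeriv θ t)).add (((hR.hasDerivAt_spaceDeriv θ t).sub_const _).mul
      (h.smooth.spaceDeriv.hasDerivAt_spaceDeriv θ t))).const_mul (1 / 4)).deriv.trans ?_
    ring
  have hd := ((h.smooth.hasDerivAt_timeDeriv θ t).pow 3).mul
    (((h.smooth.spaceDeriv.spaceDeriv.hasDerivAt_timeDeriv θ t).const_mul 4).add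
      (h.smooth.hasDerivAt_timeDeriv θ t))
  rw [h.spaceDeriv_flux]
  have e : (fun s => R θ s) =
      fun s => u θ s ^ 3 * (4 * spaceDeriv (spaceDeriv u) θ s + u θ s) :=
    funext fun s => h.curvature_eq θ s
  rw [timeDeriv, e]
  refine (HasDerivAt.deriv hd).trans ?_
  rw [huxx, h.flow θ t ht]
  simp only [Pi.pow_apply, Pi.add_apply]
  push_cast
  linear_combination -(R θ t - Rbar t) * h.curvature_eq θ t

lemma continuous_density (h : IsNormalizedYamabeFlow u R Rbar) (t : ℝ) :
    Continuous fun θ => (u θ t ^ 2)⁻¹ :=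
  h.smooth_density.continuous_fst t

lemma continuous_curvature (h : IsNormalizedYamabeFlow u R Rbar) (t : ℝ) :
    Continuous fun θ => R θ t :=
  h.smooth_curvature.continuous_fst t

lemma length_pos (h : IsNormalizedYamabeFlow u R Rbar) (t : ℝ) :
    0 < ∫ θ in (0 : ℝ)..(2 * π), (u θ t ^ 2)⁻¹ :=
  intervalIntegral.intervalIntegral_pos_of_pos ((h.continuous_density t).intervalIntegrable _ _)
    (fun θ => inv_pos.2 (pow_pos (h.pos θ t) 2)) (by positivity)

lemma total_curvature_eq (h : IsNormalizedYamabeFlow u R Rbar) (t : ℝ) :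
    ∫ θ in (0 : ℝ)..(2 * π), R θ t * (u θ t ^ 2)⁻¹ =
      Rbar t * ∫ θ in (0 : ℝ)..(2 * π), (u θ t ^ 2)⁻¹ := by
  rw [h.mean_eq, div_mul_cancel₀ _ (h.length_pos t).ne']

lemma integral_deviation (h : IsNormalizedYamabeFlow u R Rbar) (t : ℝ) :
    ∫ θ in (0 : ℝ)..(2 * π), (R θ t - Rbar t) * (u θ t ^ 2)⁻¹ = 0 := by
  have hv := h.continuous_density t
  have hR := h.continuous_curvature t
  simp only [sub_mul]
  rw [intervalIntegral.integral_sub, intervalIntegral.integral_const_mul, h.total_curvature_eq,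
    sub_self]
  all_goals exact Continuous.intervalIntegrable (by fun_prop) _ _

lemma hasDerivAt_length (h : IsNormalizedYamabeFlow u R Rbar) {t : ℝ} (ht : 0 ≤ t) :
    HasDerivAt (fun t => ∫ θ in (0 : ℝ)..(2 * π), (u θ t ^ 2)⁻¹) 0 t := by
  refine (h.smooth_density.hasDerivAt_integral 0 (2 * π) t).congr_deriv ?_
  simp only [h.timeDeriv_density ht, mul_assoc]
  rw [intervalIntegral.integral_const_mul, h.integral_deviation, mul_zero]

lemma length_eq (h : IsNormalizedYamabeFlow u R Rbar) {t : ℝ} (ht : 0 ≤ t) :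
    ∫ θ in (0 : ℝ)..(2 * π), (u θ t ^ 2)⁻¹ = 2 * π := by
  refine Eq.trans (constant_of_has_deriv_right_zero
    (f := fun t => ∫ θ in (0 : ℝ)..(2 * π), (u θ t ^ 2)⁻¹)
    (fun s hs => (h.hasDerivAt_length hs.1).continuousAt.continuousWithinAt)
    (fun s hs => (h.hasDerivAt_length hs.1).hasDerivWithinAt) t ⟨ht, le_rfl⟩) h.length

lemma mean_le_one (h : IsNormalizedYamabeFlow u R Rbar) {t : ℝ} (ht : 0 ≤ t) : Rbar t ≤ 1 := by
  have hu := h.smooth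
  have key := integral_sq_sub_deriv_sq_le (fun x => hu.hasDerivAt_spaceDeriv x t)
    (hu.spaceDeriv.continuous_fst t) (fun x => h.pos x t) (fun x => h.periodic x t)
    (fun x => spaceDeriv_periodic h.periodic x t) (h.length_eq ht)
  have hG := (hu.mul hu.spaceDeriv).const_mul 4
  have hzero := hG.integral_spaceDeriv
    (fun θ t => by rw [h.periodic, spaceDeriv_periodic h.periodic]) t
  have hu0 := hu.continuous_fst t
  have hu1 := hu.spaceDeriv.continuous_fst t
  have hu2 := hG.spaceDeriv.continuous_fst t
  have e : ∫ θ in (0 : ℝ)..(2 * π), R θ t * (u θ t ^ 2)⁻¹ =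
      ∫ θ in (0 : ℝ)..(2 * π), (u θ t ^ 2 - 4 * spaceDeriv u θ t ^ 2) := by
    have hadd := intervalIntegral.integral_add (μ := volume) (a := 0) (b := 2 * π)
      ((by fun_prop : Continuous fun θ => u θ t ^ 2 - 4 * spaceDeriv u θ t ^ 2).intervalIntegrable
        _ _) (hu2.intervalIntegrable _ _)
    rw [hzero, add_zero] at hadd
    rw [← hadd]
    refine intervalIntegral.integral_congr fun θ _ => ?_
    have hd : spaceDeriv (fun θ t => 4 * (u θ t * spaceDeriv u θ t)) θ t = _ :=
      (((hu.hasDerivAt_spaceDeriv θ t).mul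
        (hu.spaceDeriv.hasDerivAt_spaceDeriv θ t)).const_mul 4).deriv
    simp only [hd, h.curvature_eq]
    have := h.ne_zero θ t
    field_simp
    ring
  rw [h.mean_eq, h.length_eq ht, div_le_one (by positivity), e]
  exact key

lemma hasDerivAt_total_curvature (h : IsNormalizedYamabeFlow u R Rbar) {t : ℝ} (ht : 0 ≤ t) :
    HasDerivAt (fun t => ∫ θ in (0 : ℝ)..(2 * π), R θ t * (u θ t ^ 2)⁻¹)
      (1 / 2 * ∫ θ in (0 : ℝ)..(2 * π), (R θ t - Rbar t) ^ 2 * (u θ t ^ 2)⁻¹) t := by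
  refine ((h.smooth_curvature.mul h.smooth_density).hasDerivAt_integral 0 (2 * π) t).congr_deriv ?_
  have hv := h.continuous_density t
  have hR := h.continuous_curvature t
  have hq := h.smooth_flux.spaceDeriv.continuous_fst t
  have e (θ : ℝ) : timeDeriv (fun θ t => R θ t * (u θ t ^ 2)⁻¹) θ t =
      1 / 2 * ((R θ t - Rbar t) ^ 2 * (u θ t ^ 2)⁻¹) +
        1 / 2 * Rbar t * ((R θ t - Rbar t) * (u θ t ^ 2)⁻¹) +
        spaceDeriv (fun θ t => u θ t ^ 2 * spaceDeriv R θ t) θ t := by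
    refine (HasDerivAt.deriv ((h.smooth_curvature.hasDerivAt_timeDeriv θ t).mul
      (h.smooth_density.hasDerivAt_timeDeriv θ t))).trans ?_
    rw [h.timeDeriv_density ht, h.timeDeriv_curvature ht]
    have := h.ne_zero θ t
    field_simp
    ring
  simp only [e]
  rw [intervalIntegral.integral_add, intervalIntegral.integral_add,
    intervalIntegral.integral_const_mul, intervalIntegral.integral_const_mul,
    h.integral_deviation, h.smooth_flux.integral_spaceDeriv h.periodic_flux]
  · ring
  all_goals exact Continuous.intervalIntegrable (by fun_prop) _ _

lemma hasDerivAt_integral_curvature_sq (h : IsNormalizedYamabeFlow u R Rbar) {t : ℝ}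
    (ht : 0 ≤ t) :
    HasDerivAt (fun t => ∫ θ in (0 : ℝ)..(2 * π), R θ t ^ 2 * (u θ t ^ 2)⁻¹)
      (3 / 2 * (∫ θ in (0 : ℝ)..(2 * π), (R θ t - Rbar t) ^ 3 * (u θ t ^ 2)⁻¹) +
        3 * Rbar t * (∫ θ in (0 : ℝ)..(2 * π), (R θ t - Rbar t) ^ 2 * (u θ t ^ 2)⁻¹) -
        2 * ∫ θ in (0 : ℝ)..(2 * π), u θ t ^ 2 * spaceDeriv R θ t ^ 2) t := by
  refine (((h.smooth_curvature.pow 2).mul h.smooth_density).hasDerivAt_integral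
    0 (2 * π) t).congr_deriv ?_
  have hu := h.smooth.continuous_fst t
  have hv := h.continuous_density t
  have hR := h.continuous_curvature t
  have hR1 := h.smooth_curvature.spaceDeriv.continuous_fst t
  have hG := h.smooth_curvature.mul h.smooth_flux
  have hq := hG.spaceDeriv.continuous_fst t
  have e (θ : ℝ) : timeDeriv (fun θ t => R θ t ^ 2 * (u θ t ^ 2)⁻¹) θ t =
      3 / 2 * ((R θ t - Rbar t) ^ 3 * (u θ t ^ 2)⁻¹) +
        3 * Rbar t * ((R θ t - Rbar t) ^ 2 * (u θ t ^ 2)⁻¹) +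
        3 / 2 * Rbar t ^ 2 * ((R θ t - Rbar t) * (u θ t ^ 2)⁻¹) +
        2 * spaceDeriv (fun θ t => R θ t * (u θ t ^ 2 * spaceDeriv R θ t)) θ t -
        2 * (u θ t ^ 2 * spaceDeriv R θ t ^ 2) := by
    have hd : spaceDeriv (fun θ t => R θ t * (u θ t ^ 2 * spaceDeriv R θ t)) θ t = _ :=
      ((h.smooth_curvature.hasDerivAt_spaceDeriv θ t).mul
        (h.smooth_flux.hasDerivAt_spaceDeriv θ t)).deriv
    refine (HasDerivAt.deriv (((h.smooth_curvature.hasDerivAt_timeDeriv θ t).pow 2).mul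
      (h.smooth_density.hasDerivAt_timeDeriv θ t))).trans ?_
    rw [h.timeDeriv_density ht, h.timeDeriv_curvature ht, hd]
    have := h.ne_zero θ t
    simp only [Pi.pow_apply]
    field_simp
    push_cast
    ring
  simp only [e]
  rw [intervalIntegral.integral_sub, intervalIntegral.integral_add, intervalIntegral.integral_add,
    intervalIntegral.integral_add]
  · simp only [intervalIntegral.integral_const_mul, h.integral_deviation,
      hG.integral_spaceDeriv fun θ t => by rw [h.periodic_curvature, h.periodic_flux]]
    ring
  all_goals exact Continuous.intervalIntegrable (by fun_prop) _ _

lemma second_moment_eq (h : IsNormalizedYamabeFlow u R Rbar) (t : ℝ) :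
    ∫ θ in (0 : ℝ)..(2 * π), (R θ t - Rbar t) ^ 2 * (u θ t ^ 2)⁻¹ =
      (∫ θ in (0 : ℝ)..(2 * π), R θ t ^ 2 * (u θ t ^ 2)⁻¹) -
        (∫ θ in (0 : ℝ)..(2 * π), R θ t * (u θ t ^ 2)⁻¹) ^ 2 /
          ∫ θ in (0 : ℝ)..(2 * π), (u θ t ^ 2)⁻¹ := by
  have hv := h.continuous_density t
  have hR := h.continuous_curvature t
  have e (θ : ℝ) : (R θ t - Rbar t) ^ 2 * (u θ t ^ 2)⁻¹ =
      R θ t ^ 2 * (u θ t ^ 2)⁻¹ - Rbar t * (R θ t * (u θ t ^ 2)⁻¹) -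
        Rbar t * ((R θ t - Rbar t) * (u θ t ^ 2)⁻¹) := by ring
  simp only [e]
  rw [intervalIntegral.integral_sub, intervalIntegral.integral_sub,
    intervalIntegral.integral_const_mul, intervalIntegral.integral_const_mul,
    h.integral_deviation, h.mean_eq]
  · ring
  all_goals exact Continuous.intervalIntegrable (by fun_prop) _ _

lemma hasDerivAt_second_moment (h : IsNormalizedYamabeFlow u R Rbar) {t : ℝ} (ht : 0 ≤ t) :
    HasDerivAt (fun t => ∫ θ in (0 : ℝ)..(2 * π), (R θ t - Rbar t) ^ 2 * (u θ t ^ 2)⁻¹)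
      (3 / 2 * (∫ θ in (0 : ℝ)..(2 * π), (R θ t - Rbar t) ^ 3 * (u θ t ^ 2)⁻¹) +
        2 * Rbar t * (∫ θ in (0 : ℝ)..(2 * π), (R θ t - Rbar t) ^ 2 * (u θ t ^ 2)⁻¹) -
        2 * ∫ θ in (0 : ℝ)..(2 * π), u θ t ^ 2 * spaceDeriv R θ t ^ 2) t := by
  have hL := (h.length_pos t).ne'
  have hd := (h.hasDerivAt_integral_curvature_sq ht).sub
    (((h.hasDerivAt_total_curvature ht).pow 2).div (h.hasDerivAt_length ht) hL)
  refine (hd.congr_of_eventuallyEq (Eventually.of_forall h.second_moment_eq)).congr_deriv ?_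
  simp only [Pi.pow_apply, h.total_curvature_eq t]
  generalize ∫ θ in (0 : ℝ)..(2 * π), (u θ t ^ 2)⁻¹ = L at hL ⊢
  field_simp
  push_cast
  ring

lemma continuous_second_moment (h : IsNormalizedYamabeFlow u R Rbar) :
    Continuous fun t => ∫ θ in (0 : ℝ)..(2 * π), (R θ t - Rbar t) ^ 2 * (u θ t ^ 2)⁻¹ := by
  rw [funext h.second_moment_eq]
  refine continuous_iff_continuousAt.2 fun t => ContinuousAt.sub ?_ (ContinuousAt.div
    (ContinuousAt.pow ?_ 2) ?_ (h.length_pos t).ne')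
  · exact (((h.smooth_curvature.pow 2).mul h.smooth_density).hasDerivAt_integral _ _ t).continuousAt
  · exact ((h.smooth_curvature.mul h.smooth_density).hasDerivAt_integral _ _ t).continuousAt
  · exact (h.smooth_density.hasDerivAt_integral _ _ t).continuousAt

lemma continuous_mean (h : IsNormalizedYamabeFlow u R Rbar) : Continuous Rbar := by
  rw [funext h.mean_eq]
  refine continuous_iff_continuousAt.2 fun t => ContinuousAt.div ?_ ?_ (h.length_pos t).ne'
  · exact ((h.smooth_curvature.mul h.smooth_density).hasDerivAt_integral _ _ t).continuousAt
  · exact (h.smooth_density.hasDerivAt_integral _ _ t).continuousAt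

lemma smooth_energy_density (h : IsNormalizedYamabeFlow u R Rbar) :
    Smooth₂ fun θ t => u θ t ^ 2 * spaceDeriv R θ t ^ 2 :=
  (h.smooth.pow 2).mul (h.smooth_curvature.spaceDeriv.pow 2)

lemma hasDerivAt_energy (h : IsNormalizedYamabeFlow u R Rbar) {t : ℝ} (ht : 0 ≤ t) :
    HasDerivAt (fun t => ∫ θ in (0 : ℝ)..(2 * π), u θ t ^ 2 * spaceDeriv R θ t ^ 2)
      (9 / 2 * (∫ θ in (0 : ℝ)..(2 * π),
          (R θ t - Rbar t) * (u θ t ^ 2 * spaceDeriv R θ t ^ 2)) +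
        2 * Rbar t * (∫ θ in (0 : ℝ)..(2 * π), u θ t ^ 2 * spaceDeriv R θ t ^ 2) -
        2 * ∫ θ in (0 : ℝ)..(2 * π), u θ t ^ 2 *
          spaceDeriv (fun θ t => u θ t ^ 2 * spaceDeriv R θ t) θ t ^ 2) t := by
  refine (h.smooth_energy_density.hasDerivAt_integral 0 (2 * π) t).congr_deriv ?_
  have hu := h.smooth.continuous_fst t
  have hR := h.continuous_curvature t
  have hR1 := h.smooth_curvature.spaceDeriv.continuous_fst t
  have hq := h.smooth_flux.spaceDeriv.continuous_fst t
  have hG := (h.smooth.pow 2).mul (h.smooth_flux.mul h.smooth_flux.spaceDeriv)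
  have hG1 := hG.spaceDeriv.continuous_fst t
  have e (θ : ℝ) : timeDeriv (fun θ t => u θ t ^ 2 * spaceDeriv R θ t ^ 2) θ t =
      9 / 2 * ((R θ t - Rbar t) * (u θ t ^ 2 * spaceDeriv R θ t ^ 2)) +
        2 * Rbar t * (u θ t ^ 2 * spaceDeriv R θ t ^ 2) +
        2 * spaceDeriv (fun θ t => u θ t ^ 2 * ((u θ t ^ 2 * spaceDeriv R θ t) *
          spaceDeriv (fun θ t => u θ t ^ 2 * spaceDeriv R θ t) θ t)) θ t -
        2 * (u θ t ^ 2 * spaceDeriv (fun θ t => u θ t ^ 2 * spaceDeriv R θ t) θ t ^ 2) := by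
    have hd : spaceDeriv (fun θ t => u θ t ^ 2 * ((u θ t ^ 2 * spaceDeriv R θ t) *
          spaceDeriv (fun θ t => u θ t ^ 2 * spaceDeriv R θ t) θ t)) θ t = _ :=
      (((h.smooth.hasDerivAt_spaceDeriv θ t).pow 2).mul
        ((h.smooth_flux.hasDerivAt_spaceDeriv θ t).mul
          (h.smooth_flux.spaceDeriv.hasDerivAt_spaceDeriv θ t))).deriv
    have hRt : timeDeriv (spaceDeriv R) θ t =
        spaceDeriv R θ t * (R θ t - Rbar t) + R θ t * spaceDeriv R θ t +
          (2 * u θ t * spaceDeriv u θ t *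
            spaceDeriv (fun θ t => u θ t ^ 2 * spaceDeriv R θ t) θ t +
          u θ t ^ 2 *
            spaceDeriv (spaceDeriv fun θ t => u θ t ^ 2 * spaceDeriv R θ t) θ t) := by
      rw [h.smooth_curvature.timeDeriv_spaceDeriv, spaceDeriv,
        show (fun x => timeDeriv R x t) = _ from funext (h.timeDeriv_curvature ht)]
      have hR' := h.smooth_curvature.hasDerivAt_spaceDeriv θ t
      refine (HasDerivAt.deriv ((hR'.mul (hR'.sub_const (Rbar t))).add
        (((h.smooth.hasDerivAt_spaceDeriv θ t).pow 2).mul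
          (h.smooth_flux.spaceDeriv.hasDerivAt_spaceDeriv θ t)))).trans ?_
      simp only [Pi.pow_apply]
      push_cast
      ring
    refine (HasDerivAt.deriv (((h.smooth.hasDerivAt_timeDeriv θ t).pow 2).mul
      ((h.smooth_curvature.spaceDeriv.hasDerivAt_timeDeriv θ t).pow 2))).trans ?_
    rw [h.flow θ t ht, hRt, hd]
    simp only [Pi.pow_apply, Pi.mul_apply]
    push_cast
    ring
  simp only [e]
  rw [intervalIntegral.integral_sub, intervalIntegral.integral_add, intervalIntegral.integral_add]
  · simp only [intervalIntegral.integral_const_mul,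
      hG.integral_spaceDeriv fun θ t => by
        rw [h.periodic, spaceDeriv_periodic h.periodic_curvature, spaceDeriv_periodic
          (f := fun θ t => u θ t ^ 2 * spaceDeriv R θ t) h.periodic_flux]]
    ring
  all_goals exact Continuous.intervalIntegrable (by fun_prop) _ _

/-- Sobolev-type bound of the curvature deviation by its Dirichlet energy. -/
lemma abs_deviation_le (h : IsNormalizedYamabeFlow u R Rbar) {t c x : ℝ} (ht : 0 ≤ t) (hc : 0 < c)
    (hx : x ∈ Set.Icc 0 (2 * π)) :
    |R x t - Rbar t| ≤ 1 / 2 * (c * (∫ θ in (0 : ℝ)..(2 * π), u θ t ^ 2 * spaceDeriv R θ t ^ 2) +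
      c⁻¹ * (2 * π)) := by
  have hpi : (0 : ℝ) ≤ 2 * π := by positivity
  have hu := h.smooth.continuous_fst t
  have hv := h.continuous_density t
  have hR := h.continuous_curvature t
  have hR1 := h.smooth_curvature.spaceDeriv.continuous_fst t
  set K := 1 / 2 * (c * (∫ θ in (0 : ℝ)..(2 * π), u θ t ^ 2 * spaceDeriv R θ t ^ 2) +
    c⁻¹ * (2 * π))
  have hTV : ∫ θ in (0 : ℝ)..(2 * π), |spaceDeriv R θ t| ≤ K := by
    have hK' : K = ∫ θ in (0 : ℝ)..(2 * π),
        1 / 2 * (c * (u θ t ^ 2 * spaceDeriv R θ t ^ 2) + c⁻¹ * (u θ t ^ 2)⁻¹) := by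
      rw [intervalIntegral.integral_const_mul, intervalIntegral.integral_add,
        intervalIntegral.integral_const_mul, intervalIntegral.integral_const_mul, h.length_eq ht]
      all_goals exact Continuous.intervalIntegrable (by fun_prop) _ _
    rw [hK']
    refine intervalIntegral.integral_mono_on hpi
      (Continuous.intervalIntegrable (by fun_prop) _ _)
      (Continuous.intervalIntegrable (by fun_prop) _ _) fun θ _ => ?_
    have hu0 := h.pos θ t
    rw [← sub_nonneg]
    have : 1 / 2 * (c * (u θ t ^ 2 * spaceDeriv R θ t ^ 2) + c⁻¹ * (u θ t ^ 2)⁻¹) -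
        |spaceDeriv R θ t| =
        (c * u θ t ^ 2 * |spaceDeriv R θ t| - 1) ^ 2 / (2 * c * u θ t ^ 2) := by
      rw [← sq_abs (spaceDeriv R θ t)]
      field_simp
      ring
    rw [this]
    positivity
  have hosc (y : ℝ) (hy : y ∈ Set.Icc 0 (2 * π)) : |R x t - R y t| ≤ K := by
    rw [← intervalIntegral.integral_eq_sub_of_hasDerivAt
      (fun θ _ => h.smooth_curvature.hasDerivAt_spaceDeriv θ t) (hR1.intervalIntegrable y x)]
    rw [← Real.norm_eq_abs]
    refine intervalIntegral.norm_integral_le_integral_norm_uIoc.trans (le_trans ?_ hTV)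
    rw [intervalIntegral.integral_of_le hpi]
    refine setIntegral_mono_set (hR1.abs.integrableOn_Icc.mono_set Set.Ioc_subset_Icc_self)
      (Eventually.of_forall fun _ => abs_nonneg _) (Eventually.of_forall ?_)
    exact Set.Ioc_subset_Ioc (le_min hy.1 hx.1) (max_le hy.2 hx.2)
  have e : (R x t - Rbar t) * (2 * π) =
      ∫ θ in (0 : ℝ)..(2 * π), (R x t - R θ t) * (u θ t ^ 2)⁻¹ := by
    simp only [sub_mul]
    rw [intervalIntegral.integral_sub, intervalIntegral.integral_const_mul, h.total_curvature_eq,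
      h.length_eq ht]
    all_goals exact Continuous.intervalIntegrable (by fun_prop) _ _
  have hle : |R x t - Rbar t| * (2 * π) ≤ K * (2 * π) := by
    rw [← abs_of_nonneg hpi, ← abs_mul, abs_of_nonneg hpi, e]
    refine (intervalIntegral.abs_integral_le_integral_abs hpi).trans ?_
    have hK' : K * (2 * π) = ∫ θ in (0 : ℝ)..(2 * π), K * (u θ t ^ 2)⁻¹ := by
      rw [intervalIntegral.integral_const_mul, h.length_eq ht]
    rw [hK']
    refine intervalIntegral.integral_mono_on hpi
      (Continuous.intervalIntegrable (by fun_prop) _ _)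
      (Continuous.intervalIntegrable (by fun_prop) _ _) fun θ hθ => ?_
    have hv0 : 0 ≤ (u θ t ^ 2)⁻¹ := by positivity
    rw [abs_mul, abs_of_nonneg hv0]
    exact mul_le_mul_of_nonneg_right (hosc θ hθ) hv0
  exact le_of_mul_le_mul_right hle (by positivity)

lemma second_moment_nonneg (_h : IsNormalizedYamabeFlow u R Rbar) (t : ℝ) :
    0 ≤ ∫ θ in (0 : ℝ)..(2 * π), (R θ t - Rbar t) ^ 2 * (u θ t ^ 2)⁻¹ :=
  intervalIntegral.integral_nonneg (by positivity) fun θ _ => by positivity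

lemma energy_nonneg (_h : IsNormalizedYamabeFlow u R Rbar) (t : ℝ) :
    0 ≤ ∫ θ in (0 : ℝ)..(2 * π), u θ t ^ 2 * spaceDeriv R θ t ^ 2 :=
  intervalIntegral.integral_nonneg (by positivity) fun θ _ => by positivity

lemma integrableOn_second_moment (h : IsNormalizedYamabeFlow u R Rbar) :
    IntegrableOn (fun t => ∫ θ in (0 : ℝ)..(2 * π), (R θ t - Rbar t) ^ 2 * (u θ t ^ 2)⁻¹)
      (Set.Ici 0) := by
  refine integrableOn_Ici_of_le_deriv (B := 2 * (2 * π)) h.continuous_second_moment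
    (fun t _ => h.second_moment_nonneg t)
    (fun t ht => (h.hasDerivAt_total_curvature ht).const_mul 2) (fun t _ => by linarith)
    fun t ht => ?_
  simp only [h.total_curvature_eq, h.length_eq ht]
  nlinarith [h.mean_le_one ht, pi_pos]

lemma second_moment_decay (h : IsNormalizedYamabeFlow u R Rbar) :
    Tendsto (fun t => ∫ θ in (0 : ℝ)..(2 * π), (R θ t - Rbar t) ^ 2 * (u θ t ^ 2)⁻¹) atTop (𝓝 0) ∧
      IntegrableOn (fun t => ∫ θ in (0 : ℝ)..(2 * π), u θ t ^ 2 * spaceDeriv R θ t ^ 2)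
        (Set.Ici 0) := by
  have hdecay := decay_of_deriv_le (C := 2 + 3 / 2 * π) (by positivity)
    h.continuous_second_moment
    (continuous_iff_continuousAt.2 fun t =>
      (h.smooth_energy_density.hasDerivAt_integral 0 (2 * π) t).continuousAt)
    (fun t _ => h.second_moment_nonneg t) (fun t _ => h.energy_nonneg t)
    (fun t ht => h.hasDerivAt_second_moment ht) (fun t ht => ?_) h.integrableOn_second_moment
  · exact ⟨hdecay.1, hdecay.2.2⟩
  have hF := h.second_moment_nonneg t
  have hD := h.energy_nonneg t
  have hv := h.continuous_density t
  have hR := h.continuous_curvature t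
  set F := ∫ θ in (0 : ℝ)..(2 * π), (R θ t - Rbar t) ^ 2 * (u θ t ^ 2)⁻¹ with hF_def
  set D := ∫ θ in (0 : ℝ)..(2 * π), u θ t ^ 2 * spaceDeriv R θ t ^ 2
  have hc : 0 < (F + 1)⁻¹ := by positivity
  have hcube : ∫ θ in (0 : ℝ)..(2 * π), (R θ t - Rbar t) ^ 3 * (u θ t ^ 2)⁻¹ ≤
      1 / 2 * ((F + 1)⁻¹ * D + (F + 1)⁻¹⁻¹ * (2 * π)) * F := by
    rw [hF_def, ← intervalIntegral.integral_const_mul]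
    refine intervalIntegral.integral_mono_on (by positivity)
      (Continuous.intervalIntegrable (by fun_prop) _ _)
      (Continuous.intervalIntegrable (by fun_prop) _ _) fun θ hθ => ?_
    have := mul_le_mul_of_nonneg_right ((le_abs_self _).trans (h.abs_deviation_le ht hc hθ))
      (by positivity : 0 ≤ (R θ t - Rbar t) ^ 2 * (u θ t ^ 2)⁻¹)
    linarith
  have h1 : (F + 1)⁻¹ * D * F ≤ D := by
    have : (F + 1)⁻¹ * F ≤ 1 := by
      rw [inv_mul_le_iff₀ (by positivity)]; linarith
    nlinarith
  rw [inv_inv] at hcube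
  nlinarith [mul_le_mul_of_nonneg_right (h.mean_le_one ht) hF, sq_nonneg F]

lemma energy_bounded (h : IsNormalizedYamabeFlow u R Rbar) :
    ∃ B, ∀ t, 0 ≤ t → ∫ θ in (0 : ℝ)..(2 * π), u θ t ^ 2 * spaceDeriv R θ t ^ 2 ≤ B := by
  refine (decay_of_deriv_le (d := fun _ => 0) (C := 3 + 9 / 2 * π) (by positivity)
    (continuous_iff_continuousAt.2 fun t =>
      (h.smooth_energy_density.hasDerivAt_integral 0 (2 * π) t).continuousAt)
    continuous_const (fun t _ => h.energy_nonneg t) (fun _ _ => le_rfl)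
    (fun t ht => h.hasDerivAt_energy ht) (fun t ht => ?_) h.second_moment_decay.2).2.1
  have hD := h.energy_nonneg t
  have hR := h.continuous_curvature t
  have hE := h.smooth_energy_density.continuous_fst t
  set D := ∫ θ in (0 : ℝ)..(2 * π), u θ t ^ 2 * spaceDeriv R θ t ^ 2 with hD_def
  have hcube : ∫ θ in (0 : ℝ)..(2 * π), (R θ t - Rbar t) * (u θ t ^ 2 * spaceDeriv R θ t ^ 2) ≤
      1 / 2 * (1 * D + 1⁻¹ * (2 * π)) * D := by
    rw [hD_def, ← intervalIntegral.integral_const_mul]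
    exact intervalIntegral.integral_mono_on (by positivity)
      (Continuous.intervalIntegrable (by fun_prop) _ _)
      (Continuous.intervalIntegrable (by fun_prop) _ _) fun θ hθ => mul_le_mul_of_nonneg_right
        ((le_abs_self _).trans (h.abs_deviation_le ht one_pos hθ)) (by positivity)
  have hpos : 0 ≤ ∫ θ in (0 : ℝ)..(2 * π), u θ t ^ 2 *
      spaceDeriv (fun θ t => u θ t ^ 2 * spaceDeriv R θ t) θ t ^ 2 :=
    intervalIntegral.integral_nonneg (by positivity) fun θ _ => by positivity
  nlinarith [mul_le_mul_of_nonneg_right (h.mean_le_one ht) hD, sq_nonneg D,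
    mul_nonneg pi_pos.le (sq_nonneg D)]

lemma moment_decay (h : IsNormalizedYamabeFlow u R Rbar) {p : ℝ} (hp : 2 ≤ p) :
    Tendsto (fun t => ∫ θ in (0 : ℝ)..(2 * π), |R θ t - Rbar t| ^ p * (u θ t ^ 2)⁻¹) atTop (𝓝 0) ∧
      IntegrableOn (fun t => ∫ θ in (0 : ℝ)..(2 * π), |R θ t - Rbar t| ^ p * (u θ t ^ 2)⁻¹)
        (Set.Ici 0) := by
  obtain ⟨B, hB⟩ := h.energy_bounded
  have hcont : Continuous fun q : ℝ × ℝ => |R q.2 q.1 - Rbar q.1| ^ p * (u q.2 q.1 ^ 2)⁻¹ := by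
    have hR : Continuous fun q : ℝ × ℝ => R q.2 q.1 :=
      h.smooth_curvature.continuous.comp continuous_swap
    have hv : Continuous fun q : ℝ × ℝ => (u q.2 q.1 ^ 2)⁻¹ :=
      h.smooth_density.continuous.comp continuous_swap
    exact (((hR.sub (h.continuous_mean.comp continuous_fst)).abs).rpow_const
      fun _ => Or.inr (by linarith)).mul hv
  have hcontF : Continuous fun t =>
      ∫ θ in (0 : ℝ)..(2 * π), |R θ t - Rbar t| ^ p * (u θ t ^ 2)⁻¹ :=
    intervalIntegral.continuous_parametric_intervalIntegral_of_continuous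
      (f := fun t θ => |R θ t - Rbar t| ^ p * (u θ t ^ 2)⁻¹) hcont continuous_const
  have hnonneg (t : ℝ) : 0 ≤ ∫ θ in (0 : ℝ)..(2 * π), |R θ t - Rbar t| ^ p * (u θ t ^ 2)⁻¹ :=
    intervalIntegral.integral_nonneg (by positivity) fun θ _ => by positivity
  set M := 1 / 2 * (1 * B + 1⁻¹ * (2 * π)) with hM
  have hle (t : ℝ) (ht : 0 ≤ t) :
      ∫ θ in (0 : ℝ)..(2 * π), |R θ t - Rbar t| ^ p * (u θ t ^ 2)⁻¹ ≤
        M ^ (p - 2) * ∫ θ in (0 : ℝ)..(2 * π), (R θ t - Rbar t) ^ 2 * (u θ t ^ 2)⁻¹ := by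
    have hv := h.continuous_density t
    have hR := h.continuous_curvature t
    rw [← intervalIntegral.integral_const_mul]
    refine intervalIntegral.integral_mono_on (by positivity)
      (Continuous.intervalIntegrable (hcont.comp (by fun_prop : Continuous fun θ : ℝ => (t, θ))) _ _)
      (Continuous.intervalIntegrable (by fun_prop) _ _) fun θ hθ => ?_
    have hdev : |R θ t - Rbar t| ≤ M :=
      (h.abs_deviation_le ht one_pos hθ).trans (by rw [hM]; gcongr; exact hB t ht)
    have e : |R θ t - Rbar t| ^ p = |R θ t - Rbar t| ^ (p - 2) * (R θ t - Rbar t) ^ 2 := by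
      rw [← sq_abs (R θ t - Rbar t), ← rpow_natCast, ← rpow_add' (abs_nonneg _)]
      · norm_num
      · norm_num; linarith
    rw [e, mul_assoc]
    exact mul_le_mul_of_nonneg_right
      (rpow_le_rpow (abs_nonneg _) hdev (by linarith)) (by positivity)
  constructor
  · refine tendsto_of_tendsto_of_tendsto_of_le_of_le' tendsto_const_nhds
      (by simpa using h.second_moment_decay.1.const_mul (M ^ (p - 2)))
      (Eventually.of_forall hnonneg) ?_
    filter_upwards [eventually_ge_atTop 0] with t ht
    exact hle t ht
  · refine Integrable.mono' (h.integrableOn_second_moment.const_mul (M ^ (p - 2)))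
      hcontF.aestronglyMeasurable ?_
    filter_upwards [ae_restrict_mem measurableSet_Ici] with t ht
    rw [Real.norm_of_nonneg (hnonneg t)]
    exact hle t ht

end IsNormalizedYamabeFlow

/-- Decay of the curvature-deviation moments `F_p(t) = ∫ |R − R̄|^p dσ` along the
normalized Yamabe flow on S¹: for every `p ≥ 2`, `F_p(t) → 0` as `t → ∞` and
`∫₀^∞ F_p(t) dt < ∞`. -/
theorem yamabe_flow_moment_decay
    (u : ℝ → ℝ → ℝ)
    (hu : ContDiff ℝ (⊤ : ℕ∞) (fun p : ℝ × ℝ => u p.1 p.2))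
    (huper : ∀ θ t, u (θ + 2 * π) t = u θ t)
    (hupos : ∀ θ t, 0 < u θ t)
    (R : ℝ → ℝ → ℝ)
    (hR : ∀ θ t, R θ t = (u θ t) ^ 3 * (4 * deriv (deriv (fun x => u x t)) θ + u θ t))
    (Rbar : ℝ → ℝ)
    (hRbar : ∀ t, Rbar t =
      (∫ θ in (0:ℝ)..(2 * π), R θ t * ((u θ t) ^ 2)⁻¹) /
        ∫ θ in (0:ℝ)..(2 * π), ((u θ t) ^ 2)⁻¹)
    (hflow : ∀ θ t, 0 ≤ t →
      deriv (fun s => u θ s) t = (1 / 4) * (R θ t - Rbar t) * u θ t)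
    (hnorm : ∫ θ in (0:ℝ)..(2 * π), ((u θ 0) ^ 2)⁻¹ = 2 * π) :
    ∀ p : ℝ, 2 ≤ p →
      Tendsto (fun t => ∫ θ in (0:ℝ)..(2 * π),
          |R θ t - Rbar t| ^ p * ((u θ t) ^ 2)⁻¹) atTop (nhds 0)
      ∧ IntegrableOn (fun t => ∫ θ in (0:ℝ)..(2 * π),
          |R θ t - Rbar t| ^ p * ((u θ t) ^ 2)⁻¹) (Set.Ici 0) :=
  fun _ hp => IsNormalizedYamabeFlow.moment_decay
    ⟨hu, huper, hupos, hR, hRbar, hflow, hnorm⟩ hp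
end

section
/- Let u : ℝ → ℝ be a smooth function with u(θ) > 0 for all θ, and set R(θ) = u(θ)³·(4u''(θ) + u(θ)). Then the pointwise Kazdan–Warner type identity holds for all θ: (u²)'''(θ) + (u²)'(θ) = (1/2)·R'(θ)·u(θ)^{−2}. -/
open Real MeasureTheory

/-- Pointwise Kazdan–Warner type identity: for smooth positive u with
`R = u³(4u'' + u)`, one has `(u²)''' + (u²)' = ½ R' u⁻²`. -/
theorem kazdan_warner_identity
    (u : ℝ → ℝ)
    (hu : ContDiff ℝ (⊤ : ℕ∞) u)
    (hupos : ∀ θ, 0 < u θ)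
    (R : ℝ → ℝ)
    (hR : ∀ θ, R θ = (u θ) ^ 3 * (4 * deriv (deriv u) θ + u θ)) :
    ∀ θ : ℝ,
      deriv (deriv (deriv (fun x => (u x) ^ 2))) θ + deriv (fun x => (u x) ^ 2) θ
        = (1 / 2) * deriv R θ * ((u θ) ^ 2)⁻¹ := by
  have smooth_deriv : ∀ {f : ℝ → ℝ}, ContDiff ℝ (⊤ : ℕ∞) f → ContDiff ℝ (⊤ : ℕ∞) (deriv f) :=
    fun hf => (contDiff_infty_iff_deriv.mp hf).2
  have hasDeriv : ∀ {f : ℝ → ℝ}, ContDiff ℝ (⊤ : ℕ∞) f → ∀ x, HasDerivAt f (deriv f x) x :=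
    fun hf x => ((contDiff_infty_iff_deriv.mp hf).1 x).hasDerivAt
  have h₁ := hasDeriv hu
  have h₂ := hasDeriv (smooth_deriv hu)
  have h₃ := hasDeriv (smooth_deriv (smooth_deriv hu))
  have sq₁ : deriv (fun x => (u x) ^ 2) = fun x => 2 * u x * deriv u x := by
    funext x
    simpa using ((h₁ x).fun_pow 2).deriv
  have sq₂ : deriv (fun x => 2 * u x * deriv u x) =
      fun x => 2 * deriv u x * deriv u x + 2 * u x * deriv (deriv u) x := by
    funext x
    exact (((h₁ x).const_mul 2).fun_mul (h₂ x)).deriv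
  intro θ
  have sq₃ := ((((h₂ θ).const_mul 2).fun_mul (h₂ θ)).fun_add
    (((h₁ θ).const_mul 2).fun_mul (h₃ θ))).deriv
  have deriv_R := (((h₁ θ).fun_pow 3).fun_mul (((h₃ θ).const_mul 4).fun_add (h₁ θ))).deriv
  have hu₀ : u θ ≠ 0 := (hupos θ).ne'
  rw [sq₁, sq₂, sq₃, funext hR, deriv_R]
  field_simp
  push_cast
  ring
end
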